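/- arXiv:1606.05115 — 10 statements merged into one kernel-verified Lean document; each statement's English description precedes it below -/
import Mathlib

section
/- Let p be a real number with p < 0 or p > 1, let q, r ∈ (1,∞), and let k ∈ (0,1). Set k' = (1−k^q)^{1/r}. Then E_{p,q,r*}(k)·K_{p,r,q*}(k') + K_{p,q,r*}(k)·E_{p,r,q*}(k') − K_{p,q,r*}(k)·K_{p,r,q*}(k') = (1/(q·r))·B(1/q, 1−1/p)·B(1/r, 1−1/p+1/q), where B is the Euler Beta function. (This constant equals π_{p,q}·π_{s,r}/4 with 1/s = 1/p − 1/q.) -/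
open Real MeasureTheory Set Filter

/-- The Euler Beta function. -/
noncomputable def Beta (x y : ℝ) : ℝ := Real.Gamma x * Real.Gamma y / Real.Gamma (x + y)

/-- The generalized complete elliptic integral of the first kind. -/
noncomputable def genK (p q r k : ℝ) : ℝ :=
  ∫ t in (0:ℝ)..1, (1 - t ^ q) ^ (-(1 / p)) * (1 - k ^ q * t ^ q) ^ (-(1 / r))

/-- The generalized complete elliptic integral of the second kind.
Here `1 - 1/r` is `1/r*` for the Hölder conjugate `r*` of `r`. -/
noncomputable def genE (p q r k : ℝ) : ℝ :=
  ∫ t in (0:ℝ)..1, (1 - k ^ q * t ^ q) ^ (1 - 1 / r) * (1 - t ^ q) ^ (-(1 / p))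

open Topology

noncomputable def lgW (b a u : ℝ) : ℝ := u ^ (b - 1) * (1 - u) ^ (-a)

noncomputable def lgJ (b a α x : ℝ) : ℝ :=
  ∫ u in Ioo (0:ℝ) 1, lgW b a u * (1 - x * u) ^ α

lemma lgW_nonneg (b a u : ℝ) (hu : u ∈ Ioo (0:ℝ) 1) : 0 ≤ lgW b a u :=
  mul_nonneg (rpow_nonneg hu.1.le _) (rpow_nonneg (by linarith [hu.2]) _)

lemma lgW_meas (b a : ℝ) : Measurable (lgW b a) := by
  unfold lgW; fun_prop

lemma lgW_cast (b a u : ℝ) (hu : u ∈ Ioo (0:ℝ) 1) :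
    (u:ℂ) ^ ((b:ℂ) - 1) * (1 - (u:ℂ)) ^ (((1 - a : ℝ):ℂ) - 1) = ((lgW b a u : ℝ) : ℂ) := by
  unfold lgW
  have h2 : (0:ℝ) ≤ 1 - u := by linarith [hu.2]
  rw [Complex.ofReal_mul, Complex.ofReal_cpow hu.1.le, Complex.ofReal_cpow h2]
  push_cast
  congr 2
  ring

lemma lgW_int (b a : ℝ) (hb : 0 < b) (ha : a < 1) : IntegrableOn (lgW b a) (Ioo 0 1) := by
  have h := Complex.betaIntegral_convergent (u := (b:ℂ)) (v := ((1 - a : ℝ):ℂ)) (by simpa)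
    (by simp only [Complex.ofReal_re]; linarith)
  rw [intervalIntegrable_iff_integrableOn_Ioo_of_le zero_le_one] at h
  have h2 : IntegrableOn (fun u => ((lgW b a u : ℝ) : ℂ)) (Ioo 0 1) :=
    h.congr_fun (fun u hu => lgW_cast b a u hu) measurableSet_Ioo
  have := h2.re
  simp at this
  exact this

lemma lgW_val (b a : ℝ) (hb : 0 < b) (ha : a < 1) :
    ∫ u in Ioo (0:ℝ) 1, lgW b a u = Beta b (1 - a) := by
  have h := ProbabilityTheory.beta_eq_betaIntegralReal b (1 - a) hb (by linarith)
  have e : Beta b (1 - a) = ProbabilityTheory.beta b (1 - a) := rfl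
  rw [e, h, Complex.betaIntegral, intervalIntegral.integral_of_le zero_le_one,
    integral_Ioc_eq_integral_Ioo,
    setIntegral_congr_fun measurableSet_Ioo (fun u hu => lgW_cast b a u hu)]
  rw [integral_complex_ofReal, Complex.ofReal_re]

lemma lg_pow_le (lo hi s α : ℝ) (h0 : 0 < lo) (h1 : lo ≤ s) (h2 : s ≤ hi) :
    s ^ α ≤ lo ^ α + hi ^ α := by
  have hs : 0 < s := by linarith
  rcases le_total 0 α with h | h
  · have := rpow_le_rpow hs.le h2 h
    linarith [rpow_nonneg h0.le α]
  · have := rpow_le_rpow_of_nonpos h0 h1 h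
    linarith [rpow_nonneg (hs.le.trans h2) α]

lemma lg_s_bounds (x m u : ℝ) (hx : -1 < x) (hm : x ≤ m) (hm0 : 0 ≤ m) (hu : u ∈ Ioo (0:ℝ) 1) :
    1 - m ≤ 1 - x * u ∧ 1 - x * u ≤ 2 := by
  obtain ⟨h0, h1⟩ := hu
  constructor <;> nlinarith

lemma lgF_meas (b a α x : ℝ) : Measurable (fun u => lgW b a u * (1 - x * u) ^ α) := by
  have := lgW_meas b a
  fun_prop

lemma lgF_int (b a α x : ℝ) (hb : 0 < b) (ha : a < 1) (hx : x ∈ Ioo (-1:ℝ) 1) :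
    IntegrableOn (fun u => lgW b a u * (1 - x * u) ^ α) (Ioo 0 1) := by
  set m := max x 0
  have hm : m < 1 := max_lt hx.2 one_pos
  refine Integrable.mono' ((lgW_int b a hb ha).mul_const ((1 - m) ^ α + 2 ^ α))
    (lgF_meas b a α x).aestronglyMeasurable ?_
  filter_upwards [ae_restrict_mem measurableSet_Ioo] with u hu
  obtain ⟨h1, h2⟩ := lg_s_bounds x m u hx.1 (le_max_left _ _) (le_max_right _ _) hu
  have hw := lgW_nonneg b a u hu
  have hs : 0 ≤ (1 - x * u) ^ α := rpow_nonneg (by linarith) _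
  rw [Real.norm_of_nonneg (mul_nonneg hw hs)]
  exact mul_le_mul_of_nonneg_left (lg_pow_le _ _ _ _ (by linarith) h1 h2) hw

lemma lgJ_deriv (b a α x : ℝ) (hb : 0 < b) (ha : a < 1) (hx : x ∈ Ioo (-1:ℝ) 1) :
    HasDerivAt (lgJ b a α)
      (∫ u in Ioo (0:ℝ) 1, lgW b a u * (-u * α * (1 - x * u) ^ (α - 1))) x := by
  set m := (max x 0 + 1) / 2 with hmdef
  have hM : max x 0 < 1 := max_lt hx.2 one_pos
  have hm : m < 1 := by linarith
  have hm0 : 0 ≤ m := by linarith [le_max_right x 0]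
  have hxm : x < m := by linarith [le_max_left x 0]
  have hWm := lgW_meas b a
  refine (hasDerivAt_integral_of_dominated_loc_of_deriv_le (s := Ioo (-1) m)
    (F := fun x u => lgW b a u * (1 - x * u) ^ α)
    (F' := fun x u => lgW b a u * (-u * α * (1 - x * u) ^ (α - 1)))
    (bound := fun u => lgW b a u * (|α| * ((1 - m) ^ (α-1) + 2 ^ (α-1))))
    (Ioo_mem_nhds hx.1 hxm) (Eventually.of_forall fun y => (lgF_meas b a α y).aestronglyMeasurable)
    (lgF_int b a α x hb ha hx) ?_ ?_ ?_ ?_).2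
  · exact (by fun_prop : Measurable _).aestronglyMeasurable
  · filter_upwards [ae_restrict_mem measurableSet_Ioo] with u hu y hy
    obtain ⟨h1, h2⟩ := lg_s_bounds y m u hy.1 hy.2.le hm0 hu
    have hw := lgW_nonneg b a u hu
    have hs : 0 ≤ (1 - y * u) ^ (α-1) := rpow_nonneg (by linarith) _
    rw [norm_mul, Real.norm_of_nonneg hw]
    refine mul_le_mul_of_nonneg_left ?_ hw
    rw [norm_mul, norm_mul, norm_neg, Real.norm_of_nonneg hs, Real.norm_of_nonneg hu.1.le,
      Real.norm_eq_abs]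
    refine mul_le_mul ?_ (lg_pow_le _ _ _ _ (by linarith) h1 h2) hs (abs_nonneg _)
    exact mul_le_of_le_one_left (abs_nonneg _) hu.2.le
  · exact (lgW_int b a hb ha).mul_const _
  · filter_upwards [ae_restrict_mem measurableSet_Ioo] with u hu y hy
    obtain ⟨h1, h2⟩ := lg_s_bounds y m u hy.1 hy.2.le hm0 hu
    have hd : HasDerivAt (fun y => 1 - y * u) (-u) y := by
      simpa using ((hasDerivAt_id y).mul_const u).const_sub 1
    exact (hd.rpow_const (Or.inl (by linarith))).const_mul _

lemma lgJ_deriv_rel (b a α x : ℝ) (hb : 0 < b) (ha : a < 1) (hx : x ∈ Ioo (-1:ℝ) 1) :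
    x * (∫ u in Ioo (0:ℝ) 1, lgW b a u * (-u * α * (1 - x * u) ^ (α - 1)))
      = α * (lgJ b a α x - lgJ b a (α - 1) x) := by
  unfold lgJ
  rw [← integral_sub (lgF_int b a α x hb ha hx) (lgF_int b a (α-1) x hb ha hx),
    ← integral_const_mul, ← integral_const_mul]
  refine setIntegral_congr_fun measurableSet_Ioo fun u hu => ?_
  obtain ⟨h1, h2⟩ := lg_s_bounds x (max x 0) u hx.1 (le_max_left _ _) (le_max_right _ _) hu
  have hM : max x 0 < 1 := max_lt hx.2 one_pos
  have hs : 0 < 1 - x * u := by linarith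
  have e : (1 - x * u) ^ α = (1 - x * u) ^ (α - 1) * (1 - x * u) := by
    rw [rpow_sub_one hs.ne']; field_simp
  simp only [e]
  ring

lemma lgJ_hasDeriv (b a α x : ℝ) (hb : 0 < b) (ha : a < 1) (hx : x ∈ Ioo (0:ℝ) 1) :
    HasDerivAt (lgJ b a α) (α * (lgJ b a α x - lgJ b a (α - 1) x) / x) x := by
  have hx' : x ∈ Ioo (-1:ℝ) 1 := ⟨by linarith [hx.1], hx.2⟩
  have := lgJ_deriv b a α x hb ha hx'
  rw [← lgJ_deriv_rel b a α x hb ha hx', mul_div_cancel_left₀ _ hx.1.ne']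
  exact this

/-- integration by parts -/
lemma lgJ_ibp (b a c x : ℝ) (hb : 0 < b) (ha : a < 1) (hx : x ∈ Ioo (0:ℝ) 1) :
    (1 - c) * (1 - x) * lgJ b a (c - 2) x
      = b * ((x - 1) * lgJ b a (c - 1) x + lgJ b a c x)
        - (1 - a) * (lgJ b a (c - 1) x - lgJ b a c x)
        + (1 - c) * ((2 - x) * lgJ b a (c - 1) x - lgJ b a c x) := by
  have hx' : x ∈ Ioo (-1:ℝ) 1 := ⟨by linarith [hx.1], hx.2⟩
  have hx0 := hx.1
  have hx1 := hx.2
  set D : ℝ → ℝ := fun u =>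
    (b * ((x - 1) * (lgW b a u * (1 - x * u) ^ (c - 1)) + lgW b a u * (1 - x * u) ^ c)
        - (1 - a) * (lgW b a u * (1 - x * u) ^ (c - 1) - lgW b a u * (1 - x * u) ^ c)
        + (1 - c) * ((2 - x) * (lgW b a u * (1 - x * u) ^ (c - 1)) - lgW b a u * (1 - x * u) ^ c)
        - (1 - c) * (1 - x) * (lgW b a u * (1 - x * u) ^ (c - 2))) / x with hD
  have i0 := lgF_int b a c x hb ha hx'
  have i1 := lgF_int b a (c - 1) x hb ha hx'
  have i2 := lgF_int b a (c - 2) x hb ha hx'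
  have j1 : IntegrableOn (fun u => b * ((x - 1) * (lgW b a u * (1 - x * u) ^ (c - 1))
      + lgW b a u * (1 - x * u) ^ c)) (Ioo 0 1) := ((i1.const_mul (x - 1)).add i0).const_mul b
  have j2 : IntegrableOn (fun u => (1 - a) * (lgW b a u * (1 - x * u) ^ (c - 1)
      - lgW b a u * (1 - x * u) ^ c)) (Ioo 0 1) := (i1.sub i0).const_mul (1 - a)
  have j3 : IntegrableOn (fun u => (1 - c) * ((2 - x) * (lgW b a u * (1 - x * u) ^ (c - 1))
      - lgW b a u * (1 - x * u) ^ c)) (Ioo 0 1) :=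
    ((i1.const_mul (2 - x)).sub i0).const_mul (1 - c)
  have j4 := i2.const_mul ((1 - c) * (1 - x))
  have j12 : IntegrableOn (fun u => b * ((x - 1) * (lgW b a u * (1 - x * u) ^ (c - 1))
      + lgW b a u * (1 - x * u) ^ c) - (1 - a) * (lgW b a u * (1 - x * u) ^ (c - 1)
      - lgW b a u * (1 - x * u) ^ c)) (Ioo 0 1) := j1.sub j2
  have j123 : IntegrableOn (fun u => b * ((x - 1) * (lgW b a u * (1 - x * u) ^ (c - 1))
      + lgW b a u * (1 - x * u) ^ c) - (1 - a) * (lgW b a u * (1 - x * u) ^ (c - 1)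
      - lgW b a u * (1 - x * u) ^ c) + (1 - c) * ((2 - x) * (lgW b a u * (1 - x * u) ^ (c - 1))
      - lgW b a u * (1 - x * u) ^ c)) (Ioo 0 1) := j12.add j3
  have hDint : IntegrableOn D (Ioo 0 1) := (j123.sub j4).div_const x
  have hval : ∫ u in (0:ℝ)..1, D u
      = (fun u : ℝ => u ^ b * (1 - u) ^ (1 - a) * (1 - x * u) ^ (c - 1)) 1
        - (fun u : ℝ => u ^ b * (1 - u) ^ (1 - a) * (1 - x * u) ^ (c - 1)) 0 := by
    refine intervalIntegral.integral_eq_sub_of_hasDerivAt_of_le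
      (f := fun u : ℝ => u ^ b * (1 - u) ^ (1 - a) * (1 - x * u) ^ (c - 1)) (f' := D)
      zero_le_one ?_ ?_ ?_
    · have hpos : ∀ u ∈ Icc (0:ℝ) 1, 1 - x * u ≠ 0 := by
        intro u hu
        have : 0 < 1 - x * u := by nlinarith [hu.1, hu.2]
        exact this.ne'
      refine ContinuousOn.mul (ContinuousOn.mul ?_ ?_) ?_
      · exact (continuous_id.rpow_const fun u => Or.inr hb.le).continuousOn
      · exact ((continuous_const.sub continuous_id).rpow_const
          fun u => Or.inr (by linarith)).continuousOn
      · exact ContinuousOn.rpow_const (by fun_prop) fun u hu => Or.inl (hpos u hu)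
    · intro u hu
      have hu0 := hu.1
      have hu1 : 0 < 1 - u := by linarith [hu.2]
      have hs : 0 < 1 - x * u := by nlinarith [hu.1, hu.2]
      have d1 : HasDerivAt (fun u : ℝ => u ^ b) (b * u ^ (b - 1)) u :=
        Real.hasDerivAt_rpow_const (Or.inl hu0.ne')
      have d2 : HasDerivAt (fun u : ℝ => (1 - u) ^ (1 - a)) (-1 * (1 - a) * (1 - u) ^ (1 - a - 1)) u :=
        ((hasDerivAt_id u).const_sub 1).rpow_const (Or.inl hu1.ne')
      have d30 : HasDerivAt (fun u : ℝ => 1 - x * u) (-x) u := by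
        simpa using ((hasDerivAt_id u).const_mul x).const_sub 1
      have d3 := d30.rpow_const (p := c - 1) (Or.inl hs.ne')
      refine HasDerivAt.congr_deriv ((d1.mul d2).mul d3) (Eq.symm ?_)
      have e1 : u ^ b = u ^ (b - 1) * u := by rw [rpow_sub_one hu0.ne']; field_simp
      have e2 : (1 - u) ^ (1 - a) = (1 - u) ^ (-a) * (1 - u) := by
        rw [show (1 - a) = -a + 1 by ring, rpow_add_one hu1.ne']
      have e3 : (1 - x * u) ^ (c - 1) = (1 - x * u) ^ (c - 2) * (1 - x * u) := by
        rw [show (c - 1) = c - 2 + 1 by ring, rpow_add_one hs.ne']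
      have e4 : (1 - x * u) ^ c = (1 - x * u) ^ (c - 2) * (1 - x * u) ^ 2 := by
        rw [pow_two, ← mul_assoc, ← e3, rpow_sub_one hs.ne']; field_simp
      simp only [hD, lgW, Pi.mul_apply]
      rw [show 1 - a - 1 = -a by ring, show c - 1 - 1 = c - 2 by ring, e4, e3, e2, e1,
        div_eq_iff hx0.ne']
      ring
    · rw [intervalIntegrable_iff_integrableOn_Ioo_of_le zero_le_one]
      exact hDint
  have hz : ∫ u in (0:ℝ)..1, D u = 0 := by
    rw [hval]
    simp [zero_rpow hb.ne', zero_rpow (by linarith : (1 - a) ≠ 0)]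
  rw [intervalIntegral.integral_of_le zero_le_one, integral_Ioc_eq_integral_Ioo, hD,
    integral_div, div_eq_zero_iff, or_iff_left hx0.ne',
    integral_sub j123 j4, integral_add j12 j3, integral_sub j1 j2,
    integral_const_mul, integral_const_mul, integral_const_mul, integral_const_mul,
    integral_add (i1.const_mul _) i0, integral_sub i1 i0, integral_sub (i1.const_mul _) i0,
    integral_const_mul, integral_const_mul] at hz
  unfold lgJ
  linarith

lemma lgK_hasDeriv (b a c x : ℝ) (hb : 0 < b) (ha : a < 1) (hx : x ∈ Ioo (0:ℝ) 1) :
    HasDerivAt (lgJ b a (c - 1)) ((b * (lgJ b a c x - (1 - x) * lgJ b a (c - 1) x)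
      + (a - c) * (lgJ b a (c - 1) x - lgJ b a c x)) / (x * (1 - x))) x := by
  have h := lgJ_hasDeriv b a (c - 1) x hb ha hx
  have h2 := lgJ_ibp b a c x hb ha hx
  have hx0 := hx.1.ne'
  have hx1 : 1 - x ≠ 0 := by linarith [hx.2]
  convert h using 1
  rw [show c - 1 - 1 = c - 2 by ring, div_eq_div_iff (mul_ne_zero hx0 hx1) hx0]
  linear_combination (-x) * h2

noncomputable def lgL (b c a x : ℝ) : ℝ :=
  lgJ b a c x * lgJ c a (b - 1) (1 - x) + lgJ b a (c - 1) x * lgJ c a b (1 - x)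
    - lgJ b a (c - 1) x * lgJ c a (b - 1) (1 - x)

lemma lgL_deriv (b c a x : ℝ) (hb : 0 < b) (hc : 0 < c) (ha : a < 1) (hx : x ∈ Ioo (0:ℝ) 1) :
    HasDerivAt (lgL b c a) 0 x := by
  have hy : 1 - x ∈ Ioo (0:ℝ) 1 := ⟨by linarith [hx.2], by linarith [hx.1]⟩
  have dy : HasDerivAt (fun x : ℝ => 1 - x) (-1) x := (hasDerivAt_id x).const_sub 1
  have E1 := lgJ_hasDeriv b a c x hb ha hx
  have K1 := lgK_hasDeriv b a c x hb ha hx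
  have E2 := (lgJ_hasDeriv c a b (1 - x) hc ha hy).comp x dy
  have K2 := (lgK_hasDeriv c a b (1 - x) hc ha hy).comp x dy
  have := ((E1.mul K2).add (K1.mul E2)).sub (K1.mul K2)
  have hx0 := hx.1.ne'
  have hx1 : 1 - x ≠ 0 := by linarith [hx.2]
  refine HasDerivAt.congr_deriv (f := lgL b c a) this ?_
  simp only [Function.comp, sub_sub_cancel]
  field_simp
  ring

lemma lgL_const (b c a x y : ℝ) (hb : 0 < b) (hc : 0 < c) (ha : a < 1)
    (hx : x ∈ Ioo (0:ℝ) 1) (hy : y ∈ Ioo (0:ℝ) 1) : lgL b c a x = lgL b c a y :=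
  isOpen_Ioo.is_const_of_deriv_eq_zero isPreconnected_Ioo
    (fun z hz => (lgL_deriv b c a z hb hc ha hz).differentiableAt.differentiableWithinAt)
    (fun z hz => (lgL_deriv b c a z hb hc ha hz).deriv) hx hy

lemma lgJ_cont0 (b a α : ℝ) (hb : 0 < b) (ha : a < 1) :
    Tendsto (lgJ b a α) (𝓝[>] 0) (𝓝 (Beta b (1 - a))) := by
  have h := (lgJ_deriv b a α 0 hb ha (by simp)).continuousAt.tendsto
  have e : lgJ b a α 0 = Beta b (1 - a) := by
    rw [← lgW_val b a hb ha]; simp [lgJ]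
  rw [e] at h
  exact h.mono_left nhdsWithin_le_nhds

lemma lgE2_lim (b c a : ℝ) (hb : 0 < b) (hc : 0 < c) (ha : a < 1) :
    Tendsto (fun x => lgJ c a b (1 - x)) (𝓝[>] 0) (𝓝 (Beta c (1 - a + b))) := by
  have e : Beta c (1 - a + b) = ∫ u in Ioo (0:ℝ) 1, lgW c a u * (1 - u) ^ b := by
    rw [show 1 - a + b = 1 - (a - b) by ring, ← lgW_val c (a - b) hc (by linarith)]
    refine setIntegral_congr_fun measurableSet_Ioo fun u hu => ?_
    simp only [lgW]
    rw [mul_assoc, ← rpow_add (by linarith [hu.2])]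
    congr 2; ring
  rw [e]
  unfold lgJ
  refine tendsto_integral_filter_of_dominated_convergence (lgW c a)
    (Eventually.of_forall fun y => (lgF_meas c a b (1 - y)).aestronglyMeasurable) ?_
    (lgW_int c a hc ha) ?_
  · filter_upwards [Ioo_mem_nhdsGT (zero_lt_one (α := ℝ))] with x hx
    filter_upwards [ae_restrict_mem measurableSet_Ioo] with u hu
    have hw := lgW_nonneg c a u hu
    have h0 : 0 ≤ 1 - (1 - x) * u := by nlinarith [hx.1, hx.2, hu.1, hu.2]
    have h1 : 1 - (1 - x) * u ≤ 1 := by nlinarith [hx.1, hx.2, hu.1, hu.2]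
    rw [Real.norm_of_nonneg (mul_nonneg hw (rpow_nonneg h0 _))]
    exact mul_le_of_le_one_right hw (rpow_le_one h0 h1 hb.le)
  · filter_upwards with u
    have : Continuous fun x : ℝ => lgW c a u * (1 - (1 - x) * u) ^ b :=
      continuous_const.mul ((by fun_prop : Continuous fun x : ℝ => 1 - (1 - x) * u).rpow_const
        fun _ => Or.inr hb.le)
    have h := this.tendsto 0
    simp only [sub_zero, one_mul] at h
    exact h.mono_left nhdsWithin_le_nhds

lemma lgK2_lim (b c a : ℝ) (hb : 0 < b) (hc : 0 < c) (ha : a < 1) :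
    Tendsto (fun x => x * lgJ c a (b - 1) (1 - x)) (𝓝[>] 0) (𝓝 0) := by
  have e : (0:ℝ) = ∫ u in Ioo (0:ℝ) 1, (0:ℝ) := by simp
  have e2 : (fun x => x * lgJ c a (b - 1) (1 - x))
      = fun x => ∫ u in Ioo (0:ℝ) 1, x * (lgW c a u * (1 - (1 - x) * u) ^ (b - 1)) := by
    funext x; rw [integral_const_mul]; rfl
  rw [e2]
  suffices h : Tendsto (fun x => ∫ u in Ioo (0:ℝ) 1, x * (lgW c a u * (1 - (1 - x) * u) ^ (b - 1)))
      (𝓝[>] 0) (𝓝 (∫ u in Ioo (0:ℝ) 1, (0:ℝ))) by rwa [← e] at h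
  refine tendsto_integral_filter_of_dominated_convergence (lgW c a)
    (Eventually.of_forall fun y =>
      ((lgF_meas c a (b - 1) (1 - y)).const_mul y).aestronglyMeasurable) ?_
    (lgW_int c a hc ha) ?_
  · filter_upwards [Ioo_mem_nhdsGT (zero_lt_one (α := ℝ))] with x hx
    filter_upwards [ae_restrict_mem measurableSet_Ioo] with u hu
    have hw := lgW_nonneg c a u hu
    have hx0 := hx.1
    have h0 : 0 < 1 - (1 - x) * u := by nlinarith [hx.1, hx.2, hu.1, hu.2]
    have hxs : x ≤ 1 - (1 - x) * u := by nlinarith [hx.1, hx.2, hu.1, hu.2]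
    have h1 : 1 - (1 - x) * u ≤ 1 := by nlinarith [hx.1, hx.2, hu.1, hu.2]
    have hp := rpow_nonneg h0.le (b - 1)
    rw [Real.norm_of_nonneg (mul_nonneg hx0.le (mul_nonneg hw hp))]
    have e3 : (1 - (1 - x) * u) * (1 - (1 - x) * u) ^ (b - 1) = (1 - (1 - x) * u) ^ b := by
      rw [rpow_sub_one h0.ne']; field_simp
    have h4 : x * (1 - (1 - x) * u) ^ (b - 1) ≤ 1 :=
      (mul_le_mul_of_nonneg_right hxs hp).trans (e3.le.trans (rpow_le_one h0.le h1 hb.le))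
    calc _ = lgW c a u * (x * (1 - (1 - x) * u) ^ (b - 1)) := by ring
      _ ≤ _ := mul_le_of_le_one_right hw h4
  · filter_upwards [ae_restrict_mem measurableSet_Ioo] with u hu
    have : ContinuousAt (fun x : ℝ => x * (lgW c a u * (1 - (1 - x) * u) ^ (b - 1))) 0 :=
      continuousAt_id.mul (continuousAt_const.mul
        ((by fun_prop : ContinuousAt (fun x : ℝ => 1 - (1 - x) * u) 0).rpow_const
        (Or.inl (by simp only [sub_zero, one_mul]; linarith [hu.2]))))
    have h := this.tendsto
    simp only [zero_mul] at h
    exact h.mono_left nhdsWithin_le_nhds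

lemma lgL_lim (b c a : ℝ) (hb : 0 < b) (hc : 0 < c) (ha : a < 1) :
    Tendsto (lgL b c a) (𝓝[>] 0) (𝓝 (Beta b (1 - a) * Beta c (1 - a + b))) := by
  have hD := lgJ_deriv b a c 0 hb ha (by simp)
  have hs : Tendsto (fun x => ((lgJ b a c x - lgJ b a (c - 1) x) / x)) (𝓝[>] 0)
      (𝓝 ((∫ u in Ioo (0:ℝ) 1, lgW b a u * (-u * c * (1 - 0 * u) ^ (c - 1)))
        - (∫ u in Ioo (0:ℝ) 1, lgW b a u * (-u * (c - 1) * (1 - 0 * u) ^ (c - 1 - 1))))) := by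
    have h := (hD.sub (lgJ_deriv b a (c - 1) 0 hb ha (by simp))).tendsto_slope
    have h2 := h.mono_left (nhdsWithin_mono 0 (fun x (hx : 0 < x) => hx.ne'))
    refine h2.congr fun x => ?_
    have e : lgJ b a c 0 = lgJ b a (c - 1) 0 := by simp [lgJ]
    simp [slope_def_field, e]
  have h1 := hs.mul (lgK2_lim b c a hb hc ha)
  have h2 := (lgJ_cont0 b a (c - 1) hb ha).mul (lgE2_lim b c a hb hc ha)
  have h := h1.add h2
  rw [mul_zero, zero_add] at h
  refine h.congr' ?_
  filter_upwards [self_mem_nhdsWithin] with x hx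
  have hx0 : x ≠ 0 := ne_of_gt hx
  unfold lgL
  field_simp
  ring

lemma lgL_eq (b c a x : ℝ) (hb : 0 < b) (hc : 0 < c) (ha : a < 1) (hx : x ∈ Ioo (0:ℝ) 1) :
    lgL b c a x = Beta b (1 - a) * Beta c (1 - a + b) := by
  refine tendsto_nhds_unique (f := lgL b c a) (l := 𝓝[>] 0) ?_ (lgL_lim b c a hb hc ha)
  refine tendsto_const_nhds.congr' ?_
  filter_upwards [Ioo_mem_nhdsGT (zero_lt_one (α := ℝ))] with y hy
  exact lgL_const b c a x y hb hc ha hx hy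

lemma lg_subst (p q x α : ℝ) (hq : 1 < q) :
    ∫ t in (0:ℝ)..1, (1 - t ^ q) ^ (-(1 / p)) * (1 - x * t ^ q) ^ α
      = 1 / q * lgJ (1 / q) (1 / p) α x := by
  have hq0 : 0 < q := by linarith
  rw [intervalIntegral.integral_of_le zero_le_one, integral_Ioc_eq_integral_Ioo]
  have h := integral_comp_rpow_Ioi
    (fun t => (Ioo (0:ℝ) 1).indicator
      (fun t => (1 - t ^ q) ^ (-(1 / p)) * (1 - x * t ^ q) ^ α) t) (p := 1 / q) (by positivity)
  have hsub : Ioo (0:ℝ) 1 ⊆ Ioi 0 := fun t ht => ht.1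
  rw [setIntegral_indicator measurableSet_Ioo, inter_eq_right.2 hsub] at h
  rw [← h, lgJ, ← integral_const_mul]
  have : ∀ u ∈ Ioi (0:ℝ), (|1 / q| * u ^ (1 / q - 1)) • (Ioo (0:ℝ) 1).indicator
      (fun t => (1 - t ^ q) ^ (-(1 / p)) * (1 - x * t ^ q) ^ α) (u ^ (1 / q))
      = (Ioo (0:ℝ) 1).indicator
        (fun u => 1 / q * (lgW (1 / q) (1 / p) u * (1 - x * u) ^ α)) u := by
    intro u hu
    have hu0 : (0:ℝ) < u := hu
    have e : (u ^ (1 / q)) ^ q = u := by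
      rw [← rpow_mul hu0.le, one_div_mul_cancel hq0.ne', rpow_one]
    by_cases h1 : u < 1
    · have m1 : u ∈ Ioo (0:ℝ) 1 := ⟨hu0, h1⟩
      have m2 : u ^ (1 / q) ∈ Ioo (0:ℝ) 1 :=
        ⟨rpow_pos_of_pos hu0 _, rpow_lt_one hu0.le h1 (by positivity)⟩
      rw [indicator_of_mem m1, indicator_of_mem m2, e, abs_of_pos (by positivity), smul_eq_mul,
        lgW]
      ring
    · have m1 : u ∉ Ioo (0:ℝ) 1 := fun h => h1 h.2
      have m2 : u ^ (1 / q) ∉ Ioo (0:ℝ) 1 := fun h =>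
        absurd h.2 (not_lt.2 (one_le_rpow (not_lt.1 h1) (by positivity)))
      rw [indicator_of_notMem m1, indicator_of_notMem m2, smul_zero]
  rw [setIntegral_congr_fun measurableSet_Ioi this, setIntegral_indicator measurableSet_Ioo,
    inter_eq_right.2 hsub]

theorem legendre_relation_generalized
    (p q r k : ℝ) (hp : p < 0 ∨ 1 < p) (hq : 1 < q) (hr : 1 < r)
    (hk : k ∈ Ioo (0:ℝ) 1)
    (qs rs k' : ℝ) (hqs : 1 / q + 1 / qs = 1) (hrs : 1 / r + 1 / rs = 1)
    (hk' : k' = (1 - k ^ q) ^ (1 / r)) :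
    genE p q rs k * genK p r qs k' + genK p q rs k * genE p r qs k'
      - genK p q rs k * genK p r qs k'
      = (1 / (q * r)) * Beta (1 / q) (1 - 1 / p) * Beta (1 / r) (1 - 1 / p + 1 / q) := by
  have hq0 : 0 < q := by linarith
  have hr0 : 0 < r := by linarith
  have ha : 1 / p < 1 := by
    rcases hp with h | h
    · exact (one_div_neg.2 h).trans one_pos
    · rw [div_lt_one (by linarith)]; exact h
  have hx : k ^ q ∈ Ioo (0:ℝ) 1 :=
    ⟨rpow_pos_of_pos hk.1 _, rpow_lt_one hk.1.le hk.2 hq0⟩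
  have hy : k' ^ r = 1 - k ^ q := by
    rw [hk', ← rpow_mul (by linarith [hx.2]), one_div_mul_cancel hr0.ne', rpow_one]
  have e1 : genE p q rs k = 1 / q * lgJ (1 / q) (1 / p) (1 / r) (k ^ q) := by
    rw [← lg_subst p q _ _ hq, genE, show 1 - 1 / rs = 1 / r by linarith]
    simp only [mul_comm]
  have e2 : genK p q rs k = 1 / q * lgJ (1 / q) (1 / p) (1 / r - 1) (k ^ q) := by
    rw [← lg_subst p q _ _ hq, genK, show -(1 / rs) = 1 / r - 1 by linarith]
  have e3 : genE p r qs k' = 1 / r * lgJ (1 / r) (1 / p) (1 / q) (1 - k ^ q) := by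
    rw [← lg_subst p r _ _ hr, genE, show 1 - 1 / qs = 1 / q by linarith, hy]
    simp only [mul_comm]
  have e4 : genK p r qs k' = 1 / r * lgJ (1 / r) (1 / p) (1 / q - 1) (1 - k ^ q) := by
    rw [← lg_subst p r _ _ hr, genK, show -(1 / qs) = 1 / q - 1 by linarith, hy]
  have h := lgL_eq (1 / q) (1 / r) (1 / p) (k ^ q) (by positivity) (by positivity) ha hx
  rw [e1, e2, e3, e4, mul_assoc (1 / (q * r)), ← h, lgL, ← one_div_mul_one_div]
  ring
end

section
/- Let q, r ∈ (1,∞) and k ∈ (0,1). Set k' = (1−k^q)^{1/r}. Then E_{∞,q,r*}(k)·K_{∞,r,q*}(k') + K_{∞,q,r*}(k)·E_{∞,r,q*}(k') − K_{∞,q,r*}(k)·K_{∞,r,q*}(k') = (1/r)·B(1/r, 1+1/q), where B is the Euler Beta function. -/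
open Real MeasureTheory Set Filter

/-- The generalized complete elliptic integral of the first kind with `p = ∞`. -/
noncomputable def genKInf (q r k : ℝ) : ℝ :=
  ∫ t in (0:ℝ)..1, (1 - k ^ q * t ^ q) ^ (-(1 / r))

/-- The generalized complete elliptic integral of the second kind with `p = ∞`.
Here `1 - 1/r` is `1/r*` for the Hölder conjugate `r*` of `r`. -/
noncomputable def genEInf (q r k : ℝ) : ℝ :=
  ∫ t in (0:ℝ)..1, (1 - k ^ q * t ^ q) ^ (1 - 1 / r)

lemma aux_pos {q x t : ℝ} (hq : 1 < q) (hx0 : 0 < x) (hx1 : x < 1) (ht : t ∈ Icc (0:ℝ) 1) :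
    0 < 1 - x * t ^ q := by
  have h1 : t ^ q ≤ 1 := Real.rpow_le_one ht.1 ht.2 (by linarith)
  have h0 : 0 ≤ t ^ q := Real.rpow_nonneg ht.1 _
  nlinarith

lemma aux_cont {q x : ℝ} (a : ℝ) (hq : 1 < q) (hx0 : 0 < x) (hx1 : x < 1) :
    ContinuousOn (fun t : ℝ => (1 - x * t ^ q) ^ a) (Icc 0 1) := by
  apply ContinuousOn.rpow_const
  · apply ContinuousOn.sub continuousOn_const
    apply ContinuousOn.mul continuousOn_const
    exact (Real.continuous_rpow_const (by linarith)).continuousOn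
  · intro t ht
    exact Or.inl (aux_pos hq hx0 hx1 ht).ne'

lemma aux_E {q x : ℝ} (a : ℝ) (hq : 1 < q) (hx0 : 0 < x) (hx1 : x < 1) :
    (1 + q * a) * ∫ t in (0:ℝ)..1, (1 - x * t ^ q) ^ a
      = q * a * (∫ t in (0:ℝ)..1, (1 - x * t ^ q) ^ (a - 1)) + (1 - x) ^ a := by
  have i1 : IntervalIntegrable (fun t : ℝ => (1 - x * t ^ q) ^ a) volume 0 1 := by
    apply ContinuousOn.intervalIntegrable
    rw [uIcc_of_le zero_le_one]; exact aux_cont a hq hx0 hx1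
  have i2 : IntervalIntegrable (fun t : ℝ => (1 - x * t ^ q) ^ (a - 1)) volume 0 1 := by
    apply ContinuousOn.intervalIntegrable
    rw [uIcc_of_le zero_le_one]; exact aux_cont (a - 1) hq hx0 hx1
  have key := intervalIntegral.integral_eq_sub_of_hasDerivAt
    (f := fun t : ℝ => t * (1 - x * t ^ q) ^ a)
    (f' := fun t : ℝ => (1 + q * a) * (1 - x * t ^ q) ^ a - q * a * (1 - x * t ^ q) ^ (a - 1))
    (a := 0) (b := 1) ?_ ((i1.const_mul _).sub (i2.const_mul _))
  · rw [intervalIntegral.integral_sub (i1.const_mul _) (i2.const_mul _),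
      intervalIntegral.integral_const_mul, intervalIntegral.integral_const_mul] at key
    simp only [Real.one_rpow, zero_mul, one_mul, mul_one, sub_zero] at key
    linarith
  · intro t ht
    rw [uIcc_of_le zero_le_one] at ht
    have hp := aux_pos hq hx0 hx1 ht
    have h1 : HasDerivAt (fun t : ℝ => t ^ q) (q * t ^ (q - 1)) t :=
      Real.hasDerivAt_rpow_const (Or.inr hq.le)
    have h2 := (((h1.const_mul x).const_sub 1).rpow_const (p := a) (Or.inl hp.ne'))
    have h3 := (hasDerivAt_id t).mul h2
    refine HasDerivAt.congr_deriv h3 ?_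
    have e1 : t * t ^ (q - 1) = t ^ q := by
      rcases ht.1.eq_or_lt with h | h
      · rw [← h, Real.zero_rpow (by linarith : q ≠ 0)]; simp
      · rw [Real.rpow_sub_one h.ne']; field_simp
    have e2 : (1 - x * t ^ q) ^ a = (1 - x * t ^ q) * (1 - x * t ^ q) ^ (a - 1) := by
      rw [Real.rpow_sub_one hp.ne']; field_simp
    simp only [id]
    rw [e2]
    linear_combination (-(x * q * a * (1 - x * t ^ q) ^ (a - 1))) * e1

lemma aux_int {b x : ℝ} (a : ℝ) (hb : 0 < b) (hx0 : 0 < x) (hx1 : x < 1) :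
    IntervalIntegrable (fun s : ℝ => s ^ (b - 1) * (1 - s) ^ (a - 1)) volume 0 x := by
  apply IntervalIntegrable.mul_continuousOn
  · exact intervalIntegral.intervalIntegrable_rpow' (by linarith)
  · rw [uIcc_of_le hx0.le]
    apply ContinuousOn.rpow_const (by fun_prop)
    intro t ht
    left; linarith [ht.2]

lemma aux_K {q x : ℝ} (a : ℝ) (hq : 1 < q) (hx0 : 0 < x) (hx1 : x < 1) :
    q * x ^ (1 / q) * ∫ t in (0:ℝ)..1, (1 - x * t ^ q) ^ (a - 1)
      = ∫ s in (0:ℝ)..x, s ^ (1 / q - 1) * (1 - s) ^ (a - 1) := by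
  have hq0 : 0 < q := by linarith
  have hptw : ∀ t ∈ Ioc (0:ℝ) 1, q * x ^ (1 / q) * (1 - x * t ^ q) ^ (a - 1) =
      ((fun s : ℝ => s ^ (1 / q - 1) * (1 - s) ^ (a - 1)) ∘ (fun t : ℝ => x * t ^ q)) t
        * (x * (q * t ^ (q - 1))) := by
    intro t ht
    have ht0 := ht.1
    have htq : 0 < t ^ q := Real.rpow_pos_of_pos ht0 q
    simp only [Function.comp]
    rw [Real.rpow_sub_one (mul_pos hx0 htq).ne', Real.mul_rpow hx0.le htq.le,
      ← Real.rpow_mul ht0.le, mul_one_div_cancel hq0.ne', Real.rpow_one,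
      Real.rpow_sub_one ht0.ne']
    field_simp
  have him : (fun t : ℝ => x * t ^ q) '' Icc 0 1 ⊆ Icc 0 x := by
    rintro _ ⟨t, ht, rfl⟩
    have h1 : t ^ q ≤ 1 := Real.rpow_le_one ht.1 ht.2 (by linarith)
    have h0 : 0 ≤ t ^ q := Real.rpow_nonneg ht.1 _
    constructor
    · positivity
    · simp only; nlinarith
  have key := intervalIntegral.integral_comp_mul_deriv''' (a := 0) (b := 1)
    (f := fun t : ℝ => x * t ^ q) (f' := fun t => x * (q * t ^ (q - 1)))
    (g := fun s : ℝ => s ^ (1 / q - 1) * (1 - s) ^ (a - 1)) ?_ ?_ ?_ ?_ ?_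
  · rw [← intervalIntegral.integral_const_mul]
    simp only [Real.one_rpow, Real.zero_rpow hq0.ne', mul_one, mul_zero] at key
    rw [← key]
    apply intervalIntegral.integral_congr_ae
    refine Eventually.of_forall fun t ht => ?_
    rw [uIoc_of_le zero_le_one] at ht
    exact hptw t ht
  · exact (continuous_const.mul (Real.continuous_rpow_const hq0.le)).continuousOn
  · intro t _
    exact ((Real.hasDerivAt_rpow_const (Or.inr hq.le)).const_mul x).hasDerivWithinAt
  · rw [min_eq_left zero_le_one, max_eq_right zero_le_one]
    rintro _ ⟨t, ht, rfl⟩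
    have hp := aux_pos hq hx0 hx1 ⟨ht.1.le, ht.2.le⟩
    have htq : 0 < x * t ^ q := mul_pos hx0 (Real.rpow_pos_of_pos ht.1 q)
    apply ContinuousAt.continuousWithinAt
    apply ContinuousAt.mul
    · exact continuousAt_id.rpow_const (Or.inl htq.ne')
    · exact (continuousAt_const.sub continuousAt_id).rpow_const (Or.inl hp.ne')
  · rw [uIcc_of_le zero_le_one]
    refine IntegrableOn.mono_set ?_ him
    have := aux_int (b := 1 / q) a (by positivity) hx0 hx1
    rwa [intervalIntegrable_iff_integrableOn_Icc_of_le hx0.le] at this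
  · rw [uIcc_of_le zero_le_one, integrableOn_Icc_iff_integrableOn_Ioc]
    have hc : IntegrableOn (fun t : ℝ => q * x ^ (1 / q) * (1 - x * t ^ q) ^ (a - 1)) (Ioc 0 1) :=
      ((continuousOn_const.mul (aux_cont (a - 1) hq hx0 hx1)).integrableOn_Icc).mono_set
        Ioc_subset_Icc_self
    exact hc.congr_fun hptw measurableSet_Ioc

lemma aux_beta {a b : ℝ} (ha : 0 < a) (hb : 0 < b) :
    ∫ s in (0:ℝ)..1, s ^ (b - 1) * (1 - s) ^ (a - 1)
      = Real.Gamma b * Real.Gamma a / Real.Gamma (b + a) := by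
  have h := ProbabilityTheory.beta_eq_betaIntegralReal b a hb ha
  rw [ProbabilityTheory.beta] at h
  rw [h, Complex.betaIntegral]
  have : ∫ s in (0:ℝ)..1, (s:ℂ) ^ ((b:ℂ) - 1) * (1 - (s:ℂ)) ^ ((a:ℂ) - 1)
      = ∫ s in (0:ℝ)..1, ((s ^ (b - 1) * (1 - s) ^ (a - 1) : ℝ) : ℂ) := by
    apply intervalIntegral.integral_congr
    intro s hs
    rw [uIcc_of_le zero_le_one] at hs
    simp only
    rw [Complex.ofReal_mul, Complex.ofReal_cpow hs.1, Complex.ofReal_cpow (by linarith [hs.2])]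
    push_cast
    rfl
  rw [this, intervalIntegral.integral_ofReal, Complex.ofReal_re]

theorem legendre_relation_generalized_inf
    (q r k : ℝ) (hq : 1 < q) (hr : 1 < r) (hk : k ∈ Ioo (0:ℝ) 1)
    (qs rs k' : ℝ) (hqs : 1 / q + 1 / qs = 1) (hrs : 1 / r + 1 / rs = 1)
    (hk' : k' = (1 - k ^ q) ^ (1 / r)) :
    genEInf q rs k * genKInf r qs k' + genKInf q rs k * genEInf r qs k'
      - genKInf q rs k * genKInf r qs k'
      = (1 / r) * Beta (1 / r) (1 + 1 / q) := by
  have hq0 : 0 < q := by linarith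
  have hr0 : 0 < r := by linarith
  have hx0 : 0 < k ^ q := Real.rpow_pos_of_pos hk.1 q
  have hx1 : k ^ q < 1 := Real.rpow_lt_one hk.1.le hk.2 hq0
  have hy : k' ^ r = 1 - k ^ q := by
    rw [hk', ← Real.rpow_mul (by linarith), one_div_mul_cancel hr0.ne', Real.rpow_one]
  have e1 : 1 - 1 / rs = 1 / r := by linarith
  have e2 : -(1 / rs) = 1 / r - 1 := by linarith
  have e3 : 1 - 1 / qs = 1 / q := by linarith
  have e4 : -(1 / qs) = 1 / q - 1 := by linarith
  unfold genEInf genKInf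
  rw [e1, e2, e3, e4, hy]
  generalize k ^ q = x at hx0 hx1
  have E1 := aux_E (1 / r) hq hx0 hx1
  have E2 := aux_E (x := 1 - x) (1 / q) hr (by linarith) (by linarith)
  have K1 := aux_K (1 / r) hq hx0 hx1
  have K2 := aux_K (x := 1 - x) (1 / q) hr (by linarith) (by linarith)
  have B := aux_beta (a := 1 / r) (b := 1 / q) (by positivity) (by positivity)
  have I1 := aux_int (b := 1 / q) (1 / r) (by positivity) hx0 hx1
  have I2 := (aux_int (b := 1 / r) (x := 1 - x) (1 / q) (by positivity)
    (by linarith) (by linarith)).comp_sub_left 1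
  have S := intervalIntegral.integral_comp_sub_left (a := x) (b := 1)
    (fun s : ℝ => s ^ (1 / r - 1) * (1 - s) ^ (1 / q - 1)) 1
  have hfun : ∀ s : ℝ, (1 - s) ^ (1 / r - 1) * s ^ (1 / q - 1)
      = s ^ (1 / q - 1) * (1 - s) ^ (1 / r - 1) := fun s => mul_comm _ _
  simp only [sub_self, sub_zero, sub_sub_cancel, hfun] at I2 S
  rw [← intervalIntegral.integral_add_adjacent_intervals I1 I2.symm, S, ← K1, ← K2] at B
  simp only [sub_sub_cancel] at E2
  unfold Beta
  have hG : Real.Gamma (1 + 1 / q) = 1 / q * Real.Gamma (1 / q) := by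
    rw [add_comm, Real.Gamma_add_one (by positivity)]
  have hG2 : Real.Gamma (1 / r + (1 + 1 / q))
      = (1 / q + 1 / r) * Real.Gamma (1 / q + 1 / r) := by
    rw [← Real.Gamma_add_one (by positivity)]; congr 1; ring
  have hGp : 0 < Real.Gamma (1 / q + 1 / r) := Real.Gamma_pos_of_pos (by positivity)
  have hR : Real.Gamma (1 / r) * Real.Gamma (1 + 1 / q) / Real.Gamma (1 / r + (1 + 1 / q))
      = (r / (q + r)) * (Real.Gamma (1 / q) * Real.Gamma (1 / r) / Real.Gamma (1 / q + 1 / r)) := by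
    rw [hG, hG2]
    generalize Real.Gamma (1 / q + 1 / r) = G at hGp
    field_simp
    try ring
  rw [hR, ← B]
  generalize (∫ t in (0:ℝ)..1, (1 - x * t ^ q) ^ (1 / r)) = E at *
  generalize (∫ t in (0:ℝ)..1, (1 - x * t ^ q) ^ (1 / r - 1)) = K at *
  generalize (∫ t in (0:ℝ)..1, (1 - (1 - x) * t ^ r) ^ (1 / q)) = E' at *
  generalize (∫ t in (0:ℝ)..1, (1 - (1 - x) * t ^ r) ^ (1 / q - 1)) = K' at *
  clear B K1 K2 S I1 I2
  generalize (1 - x) ^ (1 / r) = u at *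
  generalize x ^ (1 / q) = v at *
  have hE : E = (q * K + r * u) / (q + r) := by
    field_simp at E1 ⊢
    linarith
  have hE' : E' = (r * K' + q * v) / (q + r) := by
    field_simp at E2 ⊢
    linarith
  rw [hE, hE']
  field_simp
  ring
end

section
/- Let p be a real number with p < 0 or p > 1, let q ∈ (1,∞), and let k ∈ (0,1). Set k' = (1−k^q)^{1/q}, K_{p,q} := K_{p,q,q*} and E_{p,q} := E_{p,q,q*}. Then E_{p,q}(k)·K_{p,q}(k') + K_{p,q}(k)·E_{p,q}(k') − K_{p,q}(k)·K_{p,q}(k') = (1/q²)·B(1/q, 1−1/p)·B(1/q, 1−1/p+1/q), where B is the Euler Beta function. -/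
open Real MeasureTheory Set Filter

namespace LegAux

noncomputable def W (a b u : ℝ) : ℝ := u ^ (a - 1) * (1 - u) ^ (b - 1)

noncomputable def J (a b s m : ℝ) : ℝ := ∫ u in Ioo (0:ℝ) 1, W a b u * (1 - m * u) ^ s

lemma W_eq_re {a b u : ℝ} (hu : u ∈ Ioo (0:ℝ) 1) :
    ((u : ℂ) ^ ((a:ℂ) - 1) * (1 - (u : ℂ)) ^ ((b:ℂ) - 1)) = ((W a b u : ℝ) : ℂ) := by
  have h1 : (0:ℝ) ≤ u := hu.1.le
  have h2 : (0:ℝ) ≤ 1 - u := by linarith [hu.2]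
  rw [W, Complex.ofReal_mul, Complex.ofReal_cpow h1, Complex.ofReal_cpow h2]
  push_cast
  rfl

lemma W_int {a b : ℝ} (ha : 0 < a) (hb : 0 < b) : IntegrableOn (W a b) (Ioo 0 1) := by
  have h := Complex.betaIntegral_convergent (u := a) (v := b) (by simpa) (by simpa)
  rw [intervalIntegrable_iff_integrableOn_Ioo_of_le zero_le_one] at h
  have h2 : IntegrableOn (fun u => ((W a b u : ℝ) : ℂ)) (Ioo 0 1) :=
    h.congr_fun (fun u hu => W_eq_re hu) measurableSet_Ioo
  have h3 := h2.re
  simp only [RCLike.re_to_complex, Complex.ofReal_re] at h3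
  exact h3

lemma W_integral {a b : ℝ} (ha : 0 < a) (hb : 0 < b) :
    ∫ u in Ioo (0:ℝ) 1, W a b u = Beta a b := by
  have h := ProbabilityTheory.beta_eq_betaIntegralReal a b ha hb
  rw [Complex.betaIntegral, intervalIntegral.integral_of_le zero_le_one,
    integral_Ioc_eq_integral_Ioo, setIntegral_congr_fun measurableSet_Ioo
      (fun u hu => W_eq_re (a := a) (b := b) hu), integral_complex_ofReal, Complex.ofReal_re] at h
  rw [← h]; rfl

lemma W_nonneg {a b u : ℝ} (hu : u ∈ Ioo (0:ℝ) 1) : 0 ≤ W a b u :=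
  mul_nonneg (rpow_nonneg hu.1.le _) (rpow_nonneg (by linarith [hu.2]) _)

lemma pos_aux {m u : ℝ} (hm : m < 1) (hu : u ∈ Icc (0:ℝ) 1) : 0 < 1 - m * u := by
  rcases le_or_gt m 0 with h | h <;> nlinarith [hu.1, hu.2, mul_nonneg (sub_nonneg.2 hm.le) hu.1]

lemma cont_aux {m : ℝ} (s : ℝ) (hm : m < 1) :
    ContinuousOn (fun u : ℝ => (1 - m * u) ^ s) (Icc 0 1) := by
  apply ContinuousOn.rpow_const (by fun_prop)
  intro u hu
  exact Or.inl (pos_aux hm hu).ne'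

lemma J_int {a b m : ℝ} (s : ℝ) (ha : 0 < a) (hb : 0 < b) (hm : m < 1) :
    IntegrableOn (fun u => W a b u * (1 - m * u) ^ s) (Ioo 0 1) :=
  (W_int ha hb).mul_continuousOn_of_subset (cont_aux s hm) measurableSet_Ioo isCompact_Icc
    Ioo_subset_Icc_self

lemma W_succ {a b u : ℝ} (hu : u ∈ Ioo (0:ℝ) 1) : W (a + 1) b u = W a b u * u := by
  rw [W, W, show a + 1 - 1 = (a - 1) + 1 by ring, rpow_add_one hu.1.ne']
  ring

/-- `J s - J (s+1) = m * ∫ u w (1-mu)^s`. -/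
lemma J_step {a b m : ℝ} (s : ℝ) (ha : 0 < a) (hb : 0 < b) (hm : m < 1) :
    J a b s m - J a b (s + 1) m = m * J (a + 1) b s m := by
  rw [J, J, J, ← integral_sub (J_int s ha hb hm) (J_int _ ha hb hm), ← integral_const_mul]
  apply setIntegral_congr_fun measurableSet_Ioo
  intro u hu
  have := pos_aux hm (Ioo_subset_Icc_self hu)
  simp only [W_succ hu, rpow_add_one this.ne']
  ring

lemma J_deriv {a b m : ℝ} (s : ℝ) (ha : 0 < a) (hb : 0 < b) (hm : m < 1) :
    HasDerivAt (J a b s) (-s * J (a + 1) b (s - 1) m) m := by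
  set M := (1 + m) / 2 with hM
  have hM1 : M < 1 := by rw [hM]; linarith
  have hmM : m < M := by rw [hM]; linarith
  have hcont : ContinuousOn (fun z : ℝ × ℝ => (1 - z.1 * z.2) ^ (s - 1))
      (Icc (m - 1) M ×ˢ Icc 0 1) := by
    apply ContinuousOn.rpow_const (by fun_prop)
    rintro ⟨x, u⟩ ⟨hx, hu⟩
    exact Or.inl (pos_aux (lt_of_le_of_lt hx.2 hM1) hu).ne'
  obtain ⟨C, hC⟩ := (isCompact_Icc.prod isCompact_Icc).exists_bound_of_continuousOn hcont
  have hs : Ioo (m - 1) M ∈ nhds m := Ioo_mem_nhds (by linarith) hmM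
  have key := hasDerivAt_integral_of_dominated_loc_of_deriv_le
    (μ := volume.restrict (Ioo (0:ℝ) 1))
    (F := fun x u => W a b u * (1 - x * u) ^ s)
    (F' := fun x u => -s * (W (a + 1) b u * (1 - x * u) ^ (s - 1)))
    (bound := fun u => |s| * (W (a + 1) b u * C)) (x₀ := m) hs
    (by
      filter_upwards [hs] with x hx
      exact (J_int s ha hb (hx.2.trans hM1)).aestronglyMeasurable)
    (J_int s ha hb hm)
    ((J_int (s - 1) (by linarith) hb hm).const_mul (-s)).aestronglyMeasurable
    (by
      refine ae_restrict_of_forall_mem measurableSet_Ioo fun u hu x hx => ?_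
      have := hC (x, u) ⟨Ioo_subset_Icc_self hx, Ioo_subset_Icc_self hu⟩
      rw [norm_mul, norm_mul, norm_neg, Real.norm_eq_abs s,
        Real.norm_of_nonneg (W_nonneg hu)]
      exact mul_le_mul_of_nonneg_left (mul_le_mul_of_nonneg_left this (W_nonneg hu))
        (abs_nonneg _))
    (((W_int (by linarith) hb).mul_const C).const_mul _)
    (by
      refine ae_restrict_of_forall_mem measurableSet_Ioo fun u hu x hx => ?_
      have hp := pos_aux (hx.2.trans hM1) (Ioo_subset_Icc_self hu)
      have h1 : HasDerivAt (fun x : ℝ => 1 - x * u) (-u) x := by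
        simpa using ((hasDerivAt_id x).mul_const u).const_sub 1
      have h2 := (h1.rpow_const (p := s) (Or.inl hp.ne')).const_mul (W a b u)
      have e : -s * (W (a + 1) b u * (1 - x * u) ^ (s - 1))
          = W a b u * (-u * s * (1 - x * u) ^ (s - 1)) := by
        rw [W_succ hu]; ring
      simp only [e]
      exact h2)
  have h2 := key.2
  rw [integral_const_mul] at h2
  exact h2

lemma J_rec {a b m : ℝ} (ha : 0 < a) (hb : 0 < b) (hm : m < 1) :
    (2 * a + b - 1) * J a b a m + ((1 - 2 * a) * (1 - m) - b + 1 - a) * J a b (a - 1) m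
      = (1 - a) * (1 - m) * J a b (a - 2) m := by
  have hc : ContinuousOn (fun u : ℝ => u ^ a * (1 - u) ^ b * (1 - m * u) ^ (a - 1)) (Icc 0 1) := by
    apply ContinuousOn.mul _ (cont_aux _ hm)
    apply Continuous.continuousOn
    exact (continuous_id.rpow_const (fun _ => Or.inr ha.le)).mul
      ((continuous_const.sub continuous_id).rpow_const (fun _ => Or.inr hb.le))
  set f' : ℝ → ℝ := fun u =>
    a * (W a b u * (1 - m * u) ^ (a - 1)) - (a + b) * (W (a + 1) b u * (1 - m * u) ^ (a - 1))
      + (1 - a) * m * (W (a + 1) b u * (1 - m * u) ^ (a - 2)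
        - W (a + 1 + 1) b u * (1 - m * u) ^ (a - 2)) with hf'
  have ha1 : 0 < a + 1 := by linarith
  have ha2 : 0 < a + 1 + 1 := by linarith
  have i1 := J_int (a - 1) ha hb hm
  have i2 := J_int (a - 1) ha1 hb hm
  have i3 := J_int (a - 2) ha1 hb hm
  have i4 := J_int (a - 2) ha2 hb hm
  have hint : IntegrableOn f' (Ioo 0 1) :=
    ((i1.const_mul a).sub (i2.const_mul (a + b))).add ((i3.sub i4).const_mul ((1 - a) * m))
  have hder : ∀ u ∈ Ioo (0:ℝ) 1,
      HasDerivAt (fun u : ℝ => u ^ a * (1 - u) ^ b * (1 - m * u) ^ (a - 1)) (f' u) u := by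
    intro u hu
    have hp := pos_aux hm (Ioo_subset_Icc_self hu)
    have hu1 : 0 < 1 - u := by linarith [hu.2]
    have d1 := (hasDerivAt_id u).rpow_const (p := a) (Or.inl hu.1.ne')
    have d2 : HasDerivAt (fun u : ℝ => (1 - u) ^ b) _ u :=
      ((hasDerivAt_id u).const_sub 1).rpow_const (p := b) (Or.inl hu1.ne')
    have d3 : HasDerivAt (fun u : ℝ => (1 - m * u) ^ (a - 1)) _ u :=
      (((hasDerivAt_id u).const_mul m).const_sub 1).rpow_const (p := a - 1) (Or.inl hp.ne')
    refine ((d1.mul d2).mul d3).congr_deriv ?_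
    simp only [hf', W_succ hu, id]
    simp only [W]
    have e1 : u ^ a = u ^ (a - 1) * u := by
      rw [← rpow_add_one hu.1.ne']; congr 1; ring
    have e2 : (1 - u) ^ b = (1 - u) ^ (b - 1) * (1 - u) := by
      rw [← rpow_add_one hu1.ne']; congr 1; ring
    have e3 : (1 - m * u) ^ (a - 1) = (1 - m * u) ^ (a - 2) * (1 - m * u) := by
      rw [← rpow_add_one hp.ne']; congr 1; ring
    simp only [Pi.mul_apply, show a - 1 - 1 = a - 2 by ring]
    rw [e1, e2, e3]
    ring
  have h := intervalIntegral.integral_eq_sub_of_hasDerivAt_of_le zero_le_one hc hder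
    ((intervalIntegrable_iff_integrableOn_Ioo_of_le zero_le_one).2 hint)
  rw [intervalIntegral.integral_of_le zero_le_one, integral_Ioc_eq_integral_Ioo] at h
  have h2 : ∫ u in Ioo (0:ℝ) 1, f' u = a * J a b (a - 1) m - (a + b) * J (a + 1) b (a - 1) m
      + (1 - a) * m * (J (a + 1) b (a - 2) m - J (a + 1 + 1) b (a - 2) m) := by
    have A1 : ∫ u in Ioo (0:ℝ) 1, f' u = _ :=
      integral_add ((i1.const_mul a).sub (i2.const_mul (a + b)))
        ((i3.sub i4).const_mul ((1 - a) * m))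
    have A2 := integral_sub (i1.const_mul a) (i2.const_mul (a + b))
    have A3 := integral_sub i3 i4
    simp only [integral_const_mul] at A1 A2 A3
    rw [A1, A2, A3]
    rfl
  rw [h2] at h
  simp only [zero_rpow ha.ne', sub_self, zero_rpow hb.ne', mul_zero, zero_mul] at h
  have s1 := J_step (a - 1) ha hb hm
  have s2 := J_step (a - 2) ha hb hm
  have s3 := J_step (a - 2) ha1 hb hm
  rw [show a - 1 + 1 = a by ring] at s1
  rw [show a - 2 + 1 = a - 1 by ring] at s2 s3
  linear_combination m * h + (1 - a - (a+b)) * s1 - (1-a) * (1 - m) * s2 - (1 - a) * m * s3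

noncomputable def L (a b m : ℝ) : ℝ :=
  J a b a m * J a b (a - 1) (1 - m) + J a b (a - 1) m * J a b a (1 - m)
    - J a b (a - 1) m * J a b (a - 1) (1 - m)

lemma E_alg {a b m : ℝ} (ha : 0 < a) (hb : 0 < b) (hm : m < 1) :
    m * (-a * J (a + 1) b (a - 1) m) = a * (J a b a m - J a b (a - 1) m) := by
  have s1 := J_step (a - 1) ha hb hm
  rw [show a - 1 + 1 = a by ring] at s1
  linear_combination a * s1

lemma K_alg {a b m : ℝ} (ha : 0 < a) (hb : 0 < b) (hm : m < 1) :
    m * (1 - m) * (-(a - 1) * J (a + 1) b (a - 1 - 1) m)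
      = (2 * a + b - 1) * J a b a m + (-a * (1 - m) + 1 - a - b) * J a b (a - 1) m := by
  have s1 := J_step (a - 2) ha hb hm
  have s2 := J_rec ha hb hm
  rw [show a - 2 + 1 = a - 1 by ring] at s1
  rw [show a - 1 - 1 = a - 2 by ring]
  linear_combination -(1 - a) * (1 - m) * s1 - s2

lemma L_deriv {a b m : ℝ} (ha : 0 < a) (hb : 0 < b) (hm : m ∈ Ioo (0:ℝ) 1) :
    HasDerivAt (L a b) 0 m := by
  obtain ⟨h0, h1⟩ := hm
  have h1' : 1 - m < 1 := by linarith
  have dE := J_deriv a ha hb h1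
  have dK := J_deriv (a - 1) ha hb h1
  have hsub : HasDerivAt (fun x : ℝ => 1 - x) (-1) m := by
    simpa using (hasDerivAt_id m).const_sub 1
  have dE' : HasDerivAt (fun x => J a b a (1 - x)) _ m := (J_deriv a ha hb h1').comp m hsub
  have dK' : HasDerivAt (fun x => J a b (a - 1) (1 - x)) _ m :=
    (J_deriv (a - 1) ha hb h1').comp m hsub
  have e1 := E_alg ha hb h1
  have e2 := K_alg ha hb h1
  have e3 := E_alg ha hb h1'
  have e4 := K_alg ha hb h1'
  refine (((dE.mul dK').add (dK.mul dE')).sub (dK.mul dK')).congr_deriv ?_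
  have hne : m * (1 - m) ≠ 0 := mul_ne_zero h0.ne' (by linarith)
  apply mul_left_cancel₀ hne
  rw [mul_zero]
  generalize -a * J (a + 1) b (a - 1) m = DE at *
  generalize -(a - 1) * J (a + 1) b (a - 1 - 1) m = DK at *
  generalize -a * J (a + 1) b (a - 1) (1 - m) = DE' at *
  generalize -(a - 1) * J (a + 1) b (a - 1 - 1) (1 - m) = DK' at *
  generalize J a b a m = E at *
  generalize J a b (a - 1) m = K at *
  generalize J a b a (1 - m) = E' at *
  generalize J a b (a - 1) (1 - m) = K' at *
  linear_combination (1 - m) * K' * e1 + (E' - K') * e2 - m * K * e3 + (K - E) * e4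

lemma L_const {a b x y : ℝ} (ha : 0 < a) (hb : 0 < b) (hx : x ∈ Ioo (0:ℝ) 1)
    (hy : y ∈ Ioo (0:ℝ) 1) : L a b x = L a b y := by
  refine isOpen_Ioo.is_const_of_deriv_eq_zero isPreconnected_Ioo
    (fun z hz => (L_deriv ha hb hz).differentiableAt.differentiableWithinAt) ?_ hx hy
  intro z hz
  exact (L_deriv ha hb hz).deriv

lemma J_one {a b : ℝ} (ha : 0 < a) (hb : 0 < b) : J a b a 1 = Beta a (b + a) := by
  rw [← W_integral ha (by linarith), J]
  apply setIntegral_congr_fun measurableSet_Ioo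
  intro u hu
  have hu1 : 0 < 1 - u := by linarith [hu.2]
  simp only [W, one_mul, mul_assoc]
  rw [← rpow_add hu1]
  congr 2
  ring

lemma J_zero {a b s : ℝ} (ha : 0 < a) (hb : 0 < b) : J a b s 0 = Beta a b := by
  rw [← W_integral ha hb, J]; simp

lemma E_lim {a b : ℝ} (ha : 0 < a) (hb : 0 < b) :
    Tendsto (fun m => J a b a (1 - m)) (nhdsWithin 0 (Ioi 0)) (nhds (J a b a 1)) := by
  have hev : ∀ᶠ m : ℝ in nhdsWithin 0 (Ioi 0), m ∈ Ioo (0:ℝ) 1 := Ioo_mem_nhdsGT zero_lt_one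
  apply tendsto_integral_filter_of_dominated_convergence (W a b)
  · filter_upwards [hev] with m hm
    exact (J_int a ha hb (by linarith [hm.1])).aestronglyMeasurable
  · filter_upwards [hev] with m hm
    refine ae_restrict_of_forall_mem measurableSet_Ioo fun u hu => ?_
    have hp : 0 < 1 - (1 - m) * u := pos_aux (by linarith [hm.1]) (Ioo_subset_Icc_self hu)
    have hp1 : 1 - (1 - m) * u ≤ 1 := by nlinarith [hm.2, hu.1]
    rw [norm_mul, Real.norm_of_nonneg (W_nonneg hu), Real.norm_of_nonneg (rpow_nonneg hp.le _)]
    exact mul_le_of_le_one_right (W_nonneg hu) (rpow_le_one hp.le hp1 ha.le)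
  · exact W_int ha hb
  · refine ae_restrict_of_forall_mem measurableSet_Ioo fun u hu => ?_
    apply Tendsto.const_mul
    apply Tendsto.mono_left _ nhdsWithin_le_nhds
    have : Continuous (fun m : ℝ => (1 - (1 - m) * u) ^ a) :=
      Continuous.rpow_const (by fun_prop) (fun _ => Or.inr ha.le)
    simpa using this.tendsto 0

lemma mK_lim {a b : ℝ} (ha : 0 < a) (ha1 : a < 1) (hb : 0 < b) :
    Tendsto (fun m => m * J a b (a - 1) (1 - m)) (nhdsWithin 0 (Ioi 0)) (nhds 0) := by
  have hev : ∀ᶠ m : ℝ in nhdsWithin 0 (Ioi 0), m ∈ Ioo (0:ℝ) 1 := Ioo_mem_nhdsGT zero_lt_one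
  have hlim : Tendsto (fun m : ℝ => Beta a b * m ^ a) (nhdsWithin 0 (Ioi 0)) (nhds 0) := by
    apply Tendsto.mono_left _ nhdsWithin_le_nhds
    have : Continuous (fun m : ℝ => Beta a b * m ^ a) :=
      continuous_const.mul (continuous_id.rpow_const (fun _ => Or.inr ha.le))
    simpa [zero_rpow ha.ne'] using this.tendsto 0
  refine squeeze_zero' ?_ ?_ hlim
  · filter_upwards [hev] with m hm
    apply mul_nonneg hm.1.le
    apply setIntegral_nonneg measurableSet_Ioo
    intro u hu
    exact mul_nonneg (W_nonneg hu)
      (rpow_nonneg (pos_aux (by linarith [hm.1]) (Ioo_subset_Icc_self hu)).le _)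
  · filter_upwards [hev] with m hm
    have hle : J a b (a - 1) (1 - m) ≤ Beta a b * m ^ (a - 1) := by
      rw [← W_integral ha hb, ← integral_mul_const]
      apply setIntegral_mono_on (J_int _ ha hb (by linarith [hm.1])) ((W_int ha hb).mul_const _)
        measurableSet_Ioo
      intro u hu
      apply mul_le_mul_of_nonneg_left _ (W_nonneg hu)
      apply rpow_le_rpow_of_nonpos hm.1 _ (by linarith)
      nlinarith [hm.2, hu.2, hu.1]
    calc m * J a b (a - 1) (1 - m) ≤ m * (Beta a b * m ^ (a - 1)) :=
          mul_le_mul_of_nonneg_left hle hm.1.le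
      _ = Beta a b * (m ^ (a - 1) * m) := by ring
      _ = Beta a b * m ^ a := by
          rw [← rpow_add_one hm.1.ne']; congr 2; ring

lemma L_lim {a b : ℝ} (ha : 0 < a) (ha1 : a < 1) (hb : 0 < b) :
    Tendsto (L a b) (nhdsWithin 0 (Ioi 0)) (nhds (Beta a b * Beta a (b + a))) := by
  have hev : ∀ᶠ m : ℝ in nhdsWithin 0 (Ioi 0), m ∈ Ioo (0:ℝ) 1 := Ioo_mem_nhdsGT zero_lt_one
  have c1 : Tendsto (J a b (a - 1)) (nhdsWithin 0 (Ioi 0)) (nhds (J a b (a - 1) 0)) :=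
    (J_deriv (a - 1) ha hb zero_lt_one).continuousAt.tendsto.mono_left nhdsWithin_le_nhds
  have c2 : Tendsto (J (a + 1) b (a - 1)) (nhdsWithin 0 (Ioi 0)) (nhds (J (a + 1) b (a - 1) 0)) :=
    (J_deriv (a - 1) (by linarith) hb zero_lt_one).continuousAt.tendsto.mono_left
      nhdsWithin_le_nhds
  have h := (c1.mul (E_lim ha hb)).sub (c2.mul (mK_lim ha ha1 hb))
  rw [mul_zero, sub_zero, J_zero ha hb, J_one ha hb] at h
  refine h.congr' ?_
  filter_upwards [hev] with m hm
  have s1 := J_step (a - 1) ha hb hm.2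
  rw [show a - 1 + 1 = a by ring] at s1
  rw [L]
  linear_combination J a b (a - 1) (1 - m) * s1

lemma L_eq {a b m : ℝ} (ha : 0 < a) (ha1 : a < 1) (hb : 0 < b) (hm : m ∈ Ioo (0:ℝ) 1) :
    L a b m = Beta a b * Beta a (b + a) := by
  have hev : ∀ᶠ m : ℝ in nhdsWithin 0 (Ioi 0), m ∈ Ioo (0:ℝ) 1 := Ioo_mem_nhdsGT zero_lt_one
  refine tendsto_nhds_unique (f := L a b) ?_ (L_lim ha ha1 hb)
  refine tendsto_const_nhds.congr' ?_
  filter_upwards [hev] with x hx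
  exact L_const ha hb hm hx

lemma subst_pow {q : ℝ} (hq : 1 < q) (f : ℝ → ℝ) :
    ∫ t in (0:ℝ)..1, f (t ^ q) = 1 / q * ∫ u in Ioo (0:ℝ) 1, u ^ (1 / q - 1) * f u := by
  have hq0 : 0 < q := by linarith
  have ha : 0 < 1 / q := by positivity
  have h := integral_comp_rpow_Ioi_of_pos
    (g := (Ioo (0:ℝ) 1).indicator (fun t => f (t ^ q))) ha
  rw [setIntegral_indicator measurableSet_Ioo,
    inter_eq_right.2 (Ioo_subset_Ioi_self)] at h
  rw [intervalIntegral.integral_of_le zero_le_one, integral_Ioc_eq_integral_Ioo, ← h,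
    ← integral_const_mul]
  have : ∀ x ∈ Ioi (0:ℝ), (1 / q * x ^ (1 / q - 1)) •
      (Ioo (0:ℝ) 1).indicator (fun t => f (t ^ q)) (x ^ (1 / q))
      = (Ioo (0:ℝ) 1).indicator (fun u => 1 / q * (u ^ (1 / q - 1) * f u)) x := by
    intro x hx
    have hx0 : (0:ℝ) < x := hx
    have hiff : x ^ (1 / q) ∈ Ioo (0:ℝ) 1 ↔ x ∈ Ioo (0:ℝ) 1 := by
      constructor
      · intro h
        refine ⟨hx0, ?_⟩
        by_contra hcon
        exact absurd h.2 (not_lt.2 (one_le_rpow (not_lt.1 hcon) ha.le))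
      · intro h
        exact ⟨rpow_pos_of_pos hx0 _, rpow_lt_one hx0.le h.2 ha⟩
    by_cases hxm : x ∈ Ioo (0:ℝ) 1
    · rw [indicator_of_mem (hiff.2 hxm), indicator_of_mem hxm, ← rpow_mul hx0.le,
        one_div_mul_cancel hq0.ne', rpow_one, smul_eq_mul, mul_assoc]
    · rw [indicator_of_notMem (fun h => hxm (hiff.1 h)), indicator_of_notMem hxm, smul_zero]
  rw [setIntegral_congr_fun measurableSet_Ioi this, setIntegral_indicator measurableSet_Ioo,
    inter_eq_right.2 (Ioo_subset_Ioi_self)]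

lemma genK_eq {p q qs k : ℝ} (hq : 1 < q) (hqs : 1 / q + 1 / qs = 1) :
    genK p q qs k = 1 / q * J (1 / q) (1 - 1 / p) (1 / q - 1) (k ^ q) := by
  have := subst_pow hq (fun u => (1 - u) ^ (-(1 / p)) * (1 - k ^ q * u) ^ (-(1 / qs)))
  rw [genK, this, J]
  congr 2
  funext u
  rw [W, show -(1 / qs) = 1 / q - 1 by linarith, show 1 - 1 / p - 1 = -(1 / p) by ring]
  ring

lemma genE_eq {p q qs k : ℝ} (hq : 1 < q) (hqs : 1 / q + 1 / qs = 1) :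
    genE p q qs k = 1 / q * J (1 / q) (1 - 1 / p) (1 / q) (k ^ q) := by
  have := subst_pow hq (fun u => (1 - k ^ q * u) ^ (1 - 1 / qs) * (1 - u) ^ (-(1 / p)))
  rw [genE, this, J]
  congr 2
  funext u
  rw [W, show 1 - (1 / qs) = 1 / q by linarith, show 1 - 1 / p - 1 = -(1 / p) by ring]
  ring

end LegAux

theorem legendre_relation_q_eq_r
    (p q k : ℝ) (hp : p < 0 ∨ 1 < p) (hq : 1 < q) (hk : k ∈ Ioo (0:ℝ) 1)
    (qs k' : ℝ) (hqs : 1 / q + 1 / qs = 1) (hk' : k' = (1 - k ^ q) ^ (1 / q)) :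
    genE p q qs k * genK p q qs k' + genK p q qs k * genE p q qs k'
      - genK p q qs k * genK p q qs k'
      = (1 / q ^ 2) * Beta (1 / q) (1 - 1 / p) * Beta (1 / q) (1 - 1 / p + 1 / q) := by
  have hq0 : 0 < q := by linarith
  have ha : 0 < 1 / q := by positivity
  have ha1 : 1 / q < 1 := by rw [div_lt_one hq0]; exact hq
  have hb : 0 < 1 - 1 / p := by
    rcases hp with h | h
    · have : 1 / p < 0 := one_div_neg.2 h
      linarith
    · have : 1 / p < 1 := by rw [div_lt_one (by linarith)]; exact h
      linarith
  have hm : k ^ q ∈ Ioo (0:ℝ) 1 := ⟨rpow_pos_of_pos hk.1 _, rpow_lt_one hk.1.le hk.2 hq0⟩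
  have hkq : k' ^ q = 1 - k ^ q := by
    rw [hk', ← rpow_mul (by linarith [hm.2]), one_div_mul_cancel hq0.ne', rpow_one]
  have hL := LegAux.L_eq ha ha1 hb hm
  rw [LegAux.genK_eq hq hqs, LegAux.genK_eq hq hqs, LegAux.genE_eq hq hqs, LegAux.genE_eq hq hqs,
    hkq]
  rw [LegAux.L] at hL
  linear_combination (1 / q ^ 2) * hL
end

section
/- Let p ∈ (1,∞) and k ∈ (0,1). Set k' = (1−k^p)^{1/p}, K_p := K_{p,p,p*} and E_p := E_{p,p,p*}. Then E_p(k)·K_p(k') + K_p(k)·E_p(k') − K_p(k)·K_p(k') = π_p/2, where π_p := 2∫₀¹ (1−t^p)^{−1/p} dt = (2/p)·B(1/p, 1−1/p). -/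
open Real MeasureTheory Set Filter

open scoped Topology

noncomputable def legG (p c m : ℝ) : ℝ :=
  ∫ t in (0:ℝ)..1, (1 - t ^ p) ^ (-(1 / p)) * (1 - m * t ^ p) ^ c

lemma leg_s_mem {p t : ℝ} (hp : 1 < p) (ht : t ∈ uIoc (0:ℝ) 1) : 0 ≤ t ^ p ∧ t ^ p ≤ 1 := by
  rw [uIoc_of_le zero_le_one] at ht
  exact ⟨rpow_nonneg ht.1.le _, rpow_le_one ht.1.le ht.2 (by linarith)⟩

lemma leg_u_int {p : ℝ} (hp : 1 < p) :
    IntervalIntegrable (fun t : ℝ => (1 - t ^ p) ^ (-(1 / p))) volume 0 1 := by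
  have ha : 1 / p < 1 := by rw [div_lt_one (by linarith)]; exact hp
  have ha0 : 0 < 1 / p := by positivity
  have h1 : IntervalIntegrable (fun t : ℝ => (1 - t) ^ (-(1 / p))) volume 0 1 := by
    have := (intervalIntegral.intervalIntegrable_rpow' (a := 0) (b := 1)
      (r := -(1/p)) (by linarith)).comp_sub_left 1
    simpa using this.symm
  refine h1.mono_fun' (Measurable.aestronglyMeasurable (by fun_prop)) ?_
  rw [EventuallyLE, ae_restrict_iff' measurableSet_uIoc]
  have hne : ∀ᵐ t : ℝ, t ≠ 1 := by simp [ae_iff, measure_singleton]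
  filter_upwards [hne] with t h1 ht
  have hs := leg_s_mem hp ht
  rw [uIoc_of_le zero_le_one] at ht
  have ht1 : t < 1 := lt_of_le_of_ne ht.2 h1
  rw [norm_of_nonneg (rpow_nonneg (by linarith) _)]
  refine rpow_le_rpow_of_nonpos (by linarith) ?_ (by linarith)
  have : t ^ p ≤ t ^ (1:ℝ) := rpow_le_rpow_of_exponent_ge ht.1 ht.2 hp.le
  rw [rpow_one] at this
  linarith

lemma leg_pow_bd {δ z : ℝ} (c : ℝ) (hδ : 0 < δ) (h1 : δ ≤ z) (h2 : z ≤ 2) :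
    z ^ c ≤ δ ^ c + 2 ^ c := by
  have hz : 0 < z := by linarith
  rcases le_total 0 c with hc | hc
  · have := rpow_le_rpow hz.le h2 hc
    have := rpow_nonneg hδ.le c
    linarith
  · have := rpow_le_rpow_of_nonpos hδ h1 hc
    have := rpow_nonneg (zero_le_two (α := ℝ)) c
    linarith

lemma leg_d_mem {x M s : ℝ} (hx : |x| ≤ M) (hM : M < 1) (h0 : 0 ≤ s) (h1 : s ≤ 1) :
    1 - M ≤ 1 - x * s ∧ 1 - x * s ≤ 2 := by
  have : |x * s| ≤ M := by
    rw [abs_mul, abs_of_nonneg h0]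
    have := abs_nonneg x
    nlinarith
  have := abs_le.1 this
  constructor <;> linarith

lemma leg_int {p : ℝ} (hp : 1 < p) (c : ℝ) {m : ℝ} (hm : |m| < 1) :
    IntervalIntegrable (fun t : ℝ => (1 - t ^ p) ^ (-(1 / p)) * (1 - m * t ^ p) ^ c)
      volume 0 1 := by
  refine ((leg_u_int hp).mul_const ((1 - |m|) ^ c + 2 ^ c)).mono_fun' (Measurable.aestronglyMeasurable (by fun_prop)) ?_
  rw [EventuallyLE, ae_restrict_iff' measurableSet_uIoc]
  refine ae_of_all _ fun t ht => ?_
  have hs := leg_s_mem hp ht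
  have hd := leg_d_mem le_rfl hm hs.1 hs.2
  have hu : 0 ≤ (1 - t ^ p) ^ (-(1 / p)) := rpow_nonneg (by linarith) _
  rw [norm_of_nonneg (mul_nonneg hu (rpow_nonneg (by linarith) _))]
  exact mul_le_mul_of_nonneg_left (leg_pow_bd c (by linarith) hd.1 hd.2) hu

lemma leg_deriv0 {p : ℝ} (hp : 1 < p) (c : ℝ) {m : ℝ} (hm : |m| < 1) :
    HasDerivAt (legG p c) (∫ t in (0:ℝ)..1, (1 - t ^ p) ^ (-(1 / p)) *
      (-(t ^ p) * c * (1 - m * t ^ p) ^ (c - 1))) m := by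
  have hM : (1 + |m|) / 2 < 1 := by linarith
  set M := (1 + |m|) / 2 with hMdef
  refine (intervalIntegral.hasDerivAt_integral_of_dominated_loc_of_deriv_le
    (F := fun m t => (1 - t ^ p) ^ (-(1 / p)) * (1 - m * t ^ p) ^ c)
    (F' := fun m t => (1 - t ^ p) ^ (-(1 / p)) * (-(t ^ p) * c * (1 - m * t ^ p) ^ (c - 1)))
    (s := {x | |x| < M})
    (bound := fun t => (1 - t ^ p) ^ (-(1 / p)) * (|c| * ((1 - M) ^ (c - 1) + 2 ^ (c - 1))))
    ?_ ?_ (leg_int hp c hm) ?_ ?_ ?_ ?_).2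
  · exact (isOpen_lt continuous_abs continuous_const).mem_nhds
      (show |m| < M by linarith)
  · exact Eventually.of_forall fun x => Measurable.aestronglyMeasurable (by fun_prop)
  · exact Measurable.aestronglyMeasurable (by fun_prop)
  · refine ae_of_all _ fun t ht x hx => ?_
    have hs := leg_s_mem hp ht
    have hd := leg_d_mem (le_of_lt hx) hM hs.1 hs.2
    have hu : 0 ≤ (1 - t ^ p) ^ (-(1 / p)) := rpow_nonneg (by linarith) _
    have hdp : 0 ≤ (1 - x * t ^ p) ^ (c - 1) := rpow_nonneg (by linarith) _
    rw [norm_mul, norm_of_nonneg hu, norm_mul, norm_mul, norm_neg, norm_of_nonneg hs.1,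
      norm_of_nonneg hdp, Real.norm_eq_abs]
    refine mul_le_mul_of_nonneg_left ?_ hu
    refine mul_le_mul ?_ (leg_pow_bd _ (by linarith) hd.1 hd.2) hdp (abs_nonneg _)
    have := abs_nonneg c
    nlinarith
  · exact (leg_u_int hp).mul_const _
  · refine ae_of_all _ fun t ht x hx => ?_
    have hs := leg_s_mem hp ht
    have hd := leg_d_mem (le_of_lt hx) hM hs.1 hs.2
    have h1 : HasDerivAt (fun x : ℝ => 1 - x * t ^ p) (-(t ^ p)) x := by
      simpa using ((hasDerivAt_id x).mul_const (t ^ p)).const_sub 1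
    exact (h1.rpow_const (p := c) (Or.inl (by linarith))).const_mul _

lemma leg_deriv {p : ℝ} (hp : 1 < p) (c : ℝ) {m : ℝ} (h0 : m ≠ 0) (hm : |m| < 1) :
    HasDerivAt (legG p c) (c / m * (legG p c m - legG p (c - 1) m)) m := by
  have h := leg_deriv0 hp c hm
  convert h using 1
  unfold legG
  rw [← intervalIntegral.integral_sub (leg_int hp c hm) (leg_int hp (c-1) hm),
    ← intervalIntegral.integral_const_mul]
  refine intervalIntegral.integral_congr_ae (ae_of_all _ fun t ht => ?_)
  have hs := leg_s_mem hp ht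
  have hd := leg_d_mem le_rfl hm hs.1 hs.2
  have e : (1 - m * t ^ p) ^ c = (1 - m * t ^ p) ^ (c - 1) * (1 - m * t ^ p) := by
    rw [← rpow_add_one (by linarith)]; ring_nf
  rw [e]
  field_simp
  ring

lemma leg_parts {p : ℝ} (hp : 1 < p) {m : ℝ} (h0 : 0 < m) (h1 : m < 1) :
    legG p (1 / p) m + (1 - m) * (p - 2) * legG p (1 / p - 1) m
      = (p - 1) * (1 - m) * legG p (1 / p - 1 - 1) m := by
  have hm : |m| < 1 := by rw [abs_of_pos h0]; exact h1
  have hp0 : 0 < p := by linarith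
  have ha : 1 / p < 1 := by rw [div_lt_one (by linarith)]; exact hp
  have i1 := leg_int hp (1/p) hm
  have i2 := leg_int hp (1/p-1) hm
  have i3 := leg_int hp (1/p-1-1) hm
  have key := intervalIntegral.integral_eq_sub_of_hasDerivAt_of_le (a := 0) (b := 1)
    (f := fun t : ℝ => m * (t * (1 - t ^ p) ^ (1 - 1 / p) * (1 - m * t ^ p) ^ (1 / p - 1)))
    (f' := fun t : ℝ => (1 - t ^ p) ^ (-(1 / p)) * (1 - m * t ^ p) ^ (1 / p) +
      (1 - m) * (p - 2) * ((1 - t ^ p) ^ (-(1 / p)) * (1 - m * t ^ p) ^ (1 / p - 1)) -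
      (p - 1) * (1 - m) * ((1 - t ^ p) ^ (-(1 / p)) * (1 - m * t ^ p) ^ (1 / p - 1 - 1)))
    zero_le_one ?_ ?_ ((i1.add (i2.const_mul _)).sub (i3.const_mul _))
  · rw [intervalIntegral.integral_sub (i1.add (i2.const_mul _)) (i3.const_mul _),
      intervalIntegral.integral_add i1 (i2.const_mul _),
      intervalIntegral.integral_const_mul, intervalIntegral.integral_const_mul] at key
    have e : (0:ℝ) ^ (1 - 1 / p) = 0 := zero_rpow (by linarith)
    simp only [one_rpow, sub_self, e, zero_mul, mul_zero] at key
    unfold legG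
    linarith
  · have c1 : ContinuousOn (fun t : ℝ => t ^ p) (Icc 0 1) :=
      (continuous_rpow_const hp0.le).continuousOn
    refine continuousOn_const.mul ((continuousOn_id.mul ?_).mul ?_)
    · exact (continuousOn_const.sub c1).rpow_const fun _ _ => Or.inr (by linarith)
    · refine (continuousOn_const.sub (continuousOn_const.mul c1)).rpow_const fun t ht => Or.inl ?_
      have : t ^ p ≤ 1 := rpow_le_one ht.1 ht.2 hp0.le
      have : 0 ≤ t ^ p := rpow_nonneg ht.1 _
      have h : 0 < 1 - m * t ^ p := by nlinarith
      exact h.ne'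
  · intro t ht
    have hs1 : t ^ p < 1 := rpow_lt_one ht.1.le ht.2 hp0
    have hs0 : 0 < t ^ p := rpow_pos_of_pos ht.1 _
    have hu : 0 < 1 - t ^ p := by linarith
    have hd : 0 < 1 - m * t ^ p := by nlinarith
    have d1 : HasDerivAt (fun t : ℝ => t ^ p) (p * t ^ (p - 1)) t :=
      hasDerivAt_rpow_const (Or.inl ht.1.ne')
    have d2 := (d1.const_sub 1).rpow_const (p := 1 - 1 / p) (Or.inl hu.ne')
    have d3 := ((d1.const_mul m).const_sub 1).rpow_const (p := 1 / p - 1) (Or.inl hd.ne')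
    have d4 := (((hasDerivAt_id t).mul d2).mul d3).const_mul m
    refine d4.congr_deriv ?_
    simp only [id, Pi.mul_apply]
    have e1 : t ^ (p - 1) = t ^ p / t := by rw [rpow_sub_one ht.1.ne']
    have e2 : (1 - t ^ p) ^ (1 - 1 / p) = (1 - t ^ p) ^ (-(1 / p)) * (1 - t ^ p) := by
      rw [← rpow_add_one hu.ne']; ring_nf
    have e2' : (1 - t ^ p) ^ (1 - 1 / p - 1) = (1 - t ^ p) ^ (-(1 / p)) := by ring_nf
    have e3 : (1 - m * t ^ p) ^ (1 / p - 1) =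
        (1 - m * t ^ p) ^ (1 / p - 1 - 1) * (1 - m * t ^ p) := by
      rw [← rpow_add_one hd.ne']; ring_nf
    have e4 : (1 - m * t ^ p) ^ (1 / p) =
        (1 - m * t ^ p) ^ (1 / p - 1 - 1) * (1 - m * t ^ p) * (1 - m * t ^ p) := by
      rw [← e3, ← rpow_add_one hd.ne']; ring_nf
    rw [e4, e3, e2', e2, e1]
    have ht0 := ht.1.ne'
    generalize (1 - m * t ^ p) ^ (1 / p - 1 - 1) = D
    generalize (1 - t ^ p) ^ (-(1 / p)) = U
    generalize t ^ p = s
    field_simp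
    ring

noncomputable def legL (p m : ℝ) : ℝ :=
  legG p (1/p) m * legG p (1/p-1) (1-m) + legG p (1/p-1) m * legG p (1/p) (1-m)
    - legG p (1/p-1) m * legG p (1/p-1) (1-m)

lemma leg_derivK {p : ℝ} (hp : 1 < p) {m : ℝ} (h0 : 0 < m) (h1 : m < 1) :
    HasDerivAt (legG p (1/p-1))
      (1 / p * (legG p (1/p) m - (1 - m) * legG p (1/p-1) m) / (m * (1 - m))) m := by
  have hm : |m| < 1 := by rw [abs_of_pos h0]; exact h1
  refine (leg_deriv hp (1/p-1) h0.ne' hm).congr_deriv ?_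
  have := leg_parts hp h0 h1
  have h2 : 1 - m ≠ 0 := by linarith
  have h3 : p ≠ 0 := by linarith
  generalize legG p (1/p-1-1) m = J at *
  generalize legG p (1/p-1) m = K at *
  generalize legG p (1/p) m = E at *
  field_simp
  linear_combination (-1) * this

lemma legL_deriv {p : ℝ} (hp : 1 < p) {m : ℝ} (h0 : 0 < m) (h1 : m < 1) :
    HasDerivAt (legL p) 0 m := by
  have hm : |m| < 1 := by rw [abs_of_pos h0]; exact h1
  have g0 : 0 < 1 - m := by linarith
  have g1 : 1 - m < 1 := by linarith
  have hg : |1 - m| < 1 := by rw [abs_of_pos g0]; exact g1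
  have r : HasDerivAt (fun m : ℝ => 1 - m) (-1) m := by
    simpa using (hasDerivAt_id m).const_sub 1
  have dE := leg_deriv hp (1/p) h0.ne' hm
  have dK := leg_derivK hp h0 h1
  have dE' := (leg_deriv hp (1/p) g0.ne' hg).comp m r
  have dK' := (leg_derivK hp g0 g1).comp m r
  refine (((dE.mul dK').add (dK.mul dE')).sub (dK.mul dK')).congr_deriv ?_
  simp only [Function.comp]
  have h3 : p ≠ 0 := by linarith
  have h4 := g0.ne'
  have h5 : 1 - (1 - m) = m := by ring
  rw [h5]
  field_simp
  ring

lemma legE_one {p : ℝ} (hp : 1 < p) : legG p (1/p) 1 = 1 := by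
  have : legG p (1/p) 1 = ∫ t in (0:ℝ)..1, (1:ℝ) := by
    unfold legG
    refine intervalIntegral.integral_congr_ae ?_
    have hne : ∀ᵐ t : ℝ, t ≠ 1 := by simp [ae_iff, measure_singleton]
    filter_upwards [hne] with t h1 ht
    rw [uIoc_of_le zero_le_one] at ht
    have hs1 : t ^ p < 1 := rpow_lt_one ht.1.le (lt_of_le_of_ne ht.2 h1) (by linarith)
    rw [one_mul, ← rpow_add (by linarith)]
    simp
  rw [this]; simp

lemma legE_lim {p : ℝ} (hp : 1 < p) :
    Tendsto (fun m => legG p (1/p) (1 - m)) (𝓝[>] 0) (𝓝 1) := by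
  suffices Tendsto (fun m => legG p (1/p) (1 - m)) (𝓝[>] 0) (𝓝 (legG p (1/p) 1)) by
    rwa [legE_one hp] at this
  have ha : 0 < 1 / p := by positivity
  have hsm : ∀ᶠ m in 𝓝[>] (0:ℝ), m ∈ Ioo (0:ℝ) 1 := Ioo_mem_nhdsGT zero_lt_one
  refine intervalIntegral.tendsto_integral_filter_of_dominated_convergence _ ?_ ?_
    (leg_u_int hp) ?_
  · exact Eventually.of_forall fun x => Measurable.aestronglyMeasurable (by fun_prop)
  · filter_upwards [hsm] with m hm
    refine ae_of_all _ fun t ht => ?_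
    have hs := leg_s_mem hp ht
    have hu : 0 ≤ (1 - t ^ p) ^ (-(1 / p)) := rpow_nonneg (by linarith) _
    have hd0 : 0 ≤ 1 - (1 - m) * t ^ p := by nlinarith [hm.1, hm.2]
    have hd1 : 1 - (1 - m) * t ^ p ≤ 1 := by nlinarith [hm.1, hm.2]
    rw [norm_of_nonneg (mul_nonneg hu (rpow_nonneg hd0 _))]
    exact mul_le_of_le_one_right hu (rpow_le_one hd0 hd1 ha.le)
  · refine ae_of_all _ fun t ht => ?_
    have : Continuous fun m : ℝ =>
        (1 - t ^ p) ^ (-(1 / p)) * (1 - (1 - m) * t ^ p) ^ (1 / p) :=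
      continuous_const.mul ((by fun_prop : Continuous fun m : ℝ =>
        1 - (1 - m) * t ^ p).rpow_const fun _ => Or.inr ha.le)
    have h := (this.tendsto 0).mono_left (nhdsWithin_le_nhds (s := Ioi 0))
    simpa using h

lemma leg_nonneg {p : ℝ} (hp : 1 < p) (c : ℝ) {m : ℝ} (hm : |m| < 1) : 0 ≤ legG p c m := by
  refine intervalIntegral.integral_nonneg_of_ae_restrict zero_le_one ?_
  rw [EventuallyLE, ae_restrict_iff' measurableSet_Icc]
  have hne : ∀ᵐ t : ℝ, t ≠ 0 := by simp [ae_iff, measure_singleton]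
  filter_upwards [hne] with t h0 ht
  have hs := leg_s_mem hp (t := t) (by
    rw [uIoc_of_le zero_le_one]; exact ⟨lt_of_le_of_ne ht.1 h0.symm, ht.2⟩)
  have hd := leg_d_mem le_rfl hm hs.1 hs.2
  exact mul_nonneg (rpow_nonneg (by linarith) _) (rpow_nonneg (by linarith) _)

lemma leg_mono {f g : ℝ → ℝ} (hf : IntervalIntegrable f volume 0 1)
    (hg : IntervalIntegrable g volume 0 1) (h : ∀ t ∈ uIoc (0:ℝ) 1, f t ≤ g t) :
    ∫ t in (0:ℝ)..1, f t ≤ ∫ t in (0:ℝ)..1, g t := by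
  refine intervalIntegral.integral_mono_on_of_le_Ioo zero_le_one hf hg fun t ht => h t ?_
  rw [uIoc_of_le zero_le_one]; exact ⟨ht.1, ht.2.le⟩

lemma legG_zero (p c : ℝ) : legG p c 0 = ∫ t in (0:ℝ)..1, (1 - t ^ p) ^ (-(1 / p)) := by
  simp [legG]

lemma legK_bd {p : ℝ} (hp : 1 < p) {m : ℝ} (h0 : 0 < m) (h1 : m < 1) :
    legG p (1/p-1) (1-m) ≤ legG p (1/p-1) 0 * m ^ (1/p-1) := by
  have ha : 1 / p < 1 := by rw [div_lt_one (by linarith)]; exact hp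
  rw [legG_zero, ← intervalIntegral.integral_mul_const]
  refine leg_mono (leg_int hp _ (by rw [abs_of_pos] <;> linarith)) ((leg_u_int hp).mul_const _)
    fun t ht => ?_
  have hs := leg_s_mem hp ht
  have hu : 0 ≤ (1 - t ^ p) ^ (-(1 / p)) := rpow_nonneg (by linarith) _
  refine mul_le_mul_of_nonneg_left ?_ hu
  exact rpow_le_rpow_of_nonpos h0 (by nlinarith) (by linarith)

lemma legKE_bd {p : ℝ} (hp : 1 < p) {m : ℝ} (h0 : 0 < m) (h1 : m < 1) :
    |legG p (1/p) m - legG p (1/p-1) m| ≤ m * legG p (1/p-1) m := by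
  have hm : |m| < 1 := by rw [abs_of_pos h0]; exact h1
  have A : legG p (1/p) m ≤ legG p (1/p-1) m := by
    refine leg_mono (leg_int hp _ hm) (leg_int hp _ hm) fun t ht => ?_
    have hs := leg_s_mem hp ht
    have hu : 0 ≤ (1 - t ^ p) ^ (-(1 / p)) := rpow_nonneg (by linarith) _
    have hd : 0 < 1 - m * t ^ p := by nlinarith
    have hd1 : 1 - m * t ^ p ≤ 1 := by nlinarith
    exact mul_le_mul_of_nonneg_left (rpow_le_rpow_of_exponent_ge hd hd1 (by linarith)) hu
  have B : (1 - m) * legG p (1/p-1) m ≤ legG p (1/p) m := by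
    unfold legG
    rw [← intervalIntegral.integral_const_mul]
    refine leg_mono ((leg_int hp _ hm).const_mul _) (leg_int hp _ hm) fun t ht => ?_
    have hs := leg_s_mem hp ht
    have hu : 0 ≤ (1 - t ^ p) ^ (-(1 / p)) := rpow_nonneg (by linarith) _
    have hd : 0 < 1 - m * t ^ p := by nlinarith
    have e : (1 - m * t ^ p) ^ (1/p) = (1 - m * t ^ p) ^ (1/p - 1) * (1 - m * t ^ p) := by
      rw [← rpow_add_one hd.ne']; ring_nf
    rw [e]
    have hw := mul_nonneg hu (rpow_nonneg hd.le (1/p-1))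
    have hle : 1 - m ≤ 1 - m * t ^ p := by nlinarith
    have := mul_le_mul_of_nonneg_right hle hw
    linarith
  rw [abs_le]; constructor <;> linarith

lemma legL_lim {p : ℝ} (hp : 1 < p) :
    Tendsto (legL p) (𝓝[>] 0) (𝓝 (∫ t in (0:ℝ)..1, (1 - t ^ p) ^ (-(1 / p)))) := by
  have ha : 0 < 1 / p := by positivity
  have hsm : ∀ᶠ m in 𝓝[>] (0:ℝ), m ∈ Ioo (0:ℝ) 1 := Ioo_mem_nhdsGT zero_lt_one
  have hK : Tendsto (legG p (1/p-1)) (𝓝[>] 0) (𝓝 (legG p (1/p-1) 0)) :=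
    ((leg_deriv0 hp (1/p-1) (m := 0) (by simp)).continuousAt.tendsto).mono_left
      nhdsWithin_le_nhds
  have hpow : Tendsto (fun m : ℝ => m ^ (1/p)) (𝓝[>] 0) (𝓝 0) := by
    have := ((continuous_rpow_const ha.le).tendsto (0:ℝ)).mono_left
      (nhdsWithin_le_nhds (s := Ioi 0))
    rwa [zero_rpow ha.ne'] at this
  have h1 : Tendsto (fun m => (legG p (1/p) m - legG p (1/p-1) m) * legG p (1/p-1) (1-m))
      (𝓝[>] 0) (𝓝 0) := by
    have hb : Tendsto (fun m => legG p (1/p-1) m * legG p (1/p-1) 0 * m ^ (1/p))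
        (𝓝[>] 0) (𝓝 0) := by
      simpa using (hK.mul_const (legG p (1/p-1) 0)).mul hpow
    refine squeeze_zero_norm' ?_ hb
    filter_upwards [hsm] with m hm
    have hg : |1 - m| < 1 := by rw [abs_of_pos] <;> linarith [hm.1, hm.2]
    have b1 := legKE_bd hp hm.1 hm.2
    have b2 := legK_bd hp hm.1 hm.2
    have n2 := leg_nonneg hp (1/p-1) hg
    have n1 := leg_nonneg hp (1/p-1) (m := m) (by rw [abs_of_pos hm.1]; exact hm.2)
    rw [norm_mul, norm_of_nonneg n2, Real.norm_eq_abs]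
    refine (mul_le_mul b1 b2 n2 (mul_nonneg hm.1.le n1)).trans (le_of_eq ?_)
    have e : m ^ (1/p) = m ^ (1/p-1) * m := by
      rw [← rpow_add_one hm.1.ne']; ring_nf
    rw [e]; ring
  have h2 := h1.add (hK.mul (legE_lim hp))
  rw [legG_zero, zero_add, mul_one] at h2
  refine h2.congr fun m => ?_
  unfold legL
  ring

lemma legL_eq {p : ℝ} (hp : 1 < p) {m : ℝ} (h0 : 0 < m) (h1 : m < 1) :
    legL p m = ∫ t in (0:ℝ)..1, (1 - t ^ p) ^ (-(1 / p)) := by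
  have hsm : ∀ᶠ m in 𝓝[>] (0:ℝ), m ∈ Ioo (0:ℝ) 1 := Ioo_mem_nhdsGT zero_lt_one
  refine tendsto_nhds_unique (tendsto_const_nhds.congr' ?_) (legL_lim hp)
  filter_upwards [hsm] with x hx
  exact isOpen_Ioo.is_const_of_deriv_eq_zero isPreconnected_Ioo
    (fun y hy => (legL_deriv hp hy.1 hy.2).differentiableAt.differentiableWithinAt)
    (fun y hy => (legL_deriv hp hy.1 hy.2).deriv) (⟨h0, h1⟩ : m ∈ Ioo (0:ℝ) 1) hx

lemma leg_beta {p : ℝ} (hp : 1 < p) :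
    ∫ t in (0:ℝ)..1, (1 - t ^ p) ^ (-(1 / p)) = 1 / p * Beta (1 / p) (1 - 1 / p) := by
  have hp0 : 0 < p := by linarith
  have ha : 0 < 1 / p := by positivity
  have ha1 : 1 / p < 1 := by rw [div_lt_one (by linarith)]; exact hp
  have hB : Beta (1/p) (1 - 1/p) = ∫ x in (0:ℝ)..1, x ^ (1/p-1) * (1 - x) ^ (-(1/p)) := by
    have h := ProbabilityTheory.beta_eq_betaIntegralReal (1/p) (1-1/p) ha (by linarith)
    have h' : Complex.betaIntegral ((1/p : ℝ) : ℂ) ((1 - 1/p : ℝ) : ℂ) =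
        ((∫ x in (0:ℝ)..1, x ^ (1/p-1) * (1 - x) ^ (-(1/p)) : ℝ) : ℂ) := by
      unfold Complex.betaIntegral
      rw [← intervalIntegral.integral_ofReal]
      refine intervalIntegral.integral_congr_ae (ae_of_all _ fun x hx => ?_)
      rw [uIoc_of_le zero_le_one] at hx
      rw [Complex.ofReal_mul, Complex.ofReal_cpow hx.1.le, Complex.ofReal_cpow (by linarith [hx.2])]
      push_cast
      ring_nf
    rw [h', Complex.ofReal_re] at h
    exact h
  have key := integral_comp_rpow_Ioi_of_pos
    (g := (Iic (1:ℝ)).indicator fun t => (1 - t ^ p) ^ (-(1 / p))) ha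
  rw [setIntegral_indicator measurableSet_Iic, Ioi_inter_Iic,
    ← intervalIntegral.integral_of_le zero_le_one] at key
  rw [← key, hB, ← intervalIntegral.integral_const_mul,
    intervalIntegral.integral_of_le zero_le_one, ← Ioi_inter_Iic,
    ← setIntegral_indicator measurableSet_Iic]
  refine setIntegral_congr_fun measurableSet_Ioi fun x hx => ?_
  have hx : 0 < x := hx
  have e : (x ^ (1/p)) ^ p = x := by
    rw [← rpow_mul hx.le, one_div_mul_cancel hp0.ne', rpow_one]
  by_cases h : x ≤ 1
  · have h' : x ^ (1/p) ≤ 1 := rpow_le_one hx.le h ha.le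
    simp only [indicator, mem_Iic, h, h', if_true, e, smul_eq_mul]
    ring
  · have h' : ¬ x ^ (1/p) ≤ 1 := not_le.2 (one_lt_rpow (not_le.1 h) ha)
    simp only [indicator, mem_Iic, h, h', if_false, smul_eq_mul, mul_zero]

theorem legendre_relation_p
    (p k : ℝ) (hp : 1 < p) (hk : k ∈ Ioo (0:ℝ) 1)
    (ps k' : ℝ) (hps : 1 / p + 1 / ps = 1) (hk' : k' = (1 - k ^ p) ^ (1 / p))
    (pip : ℝ) (hpip : pip = 2 * ∫ t in (0:ℝ)..1, (1 - t ^ p) ^ (-(1 / p))) :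
    genE p p ps k * genK p p ps k' + genK p p ps k * genE p p ps k'
      - genK p p ps k * genK p p ps k' = pip / 2
    ∧ pip = (2 / p) * Beta (1 / p) (1 - 1 / p) := by
  have hp0 : 0 < p := by linarith
  have h0 : 0 < k ^ p := rpow_pos_of_pos hk.1 _
  have h1 : k ^ p < 1 := rpow_lt_one hk.1.le hk.2 hp0
  have hkp : k' ^ p = 1 - k ^ p := by
    rw [hk', ← rpow_mul (by linarith), one_div_mul_cancel hp0.ne', rpow_one]
  have e1 : 1 - 1 / ps = 1 / p := by linarith
  have e2 : -(1 / ps) = 1 / p - 1 := by linarith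
  have hE : ∀ x, genE p p ps x = legG p (1/p) (x ^ p) := fun x => by
    unfold genE legG
    rw [e1]
    simp only [mul_comm]
  have hK : ∀ x, genK p p ps x = legG p (1/p-1) (x ^ p) := fun x => by
    unfold genK legG
    rw [e2]
  refine ⟨?_, ?_⟩
  · have h := legL_eq hp h0 h1
    unfold legL at h
    rw [hE, hE, hK, hK, hkp, h, hpip]
    ring
  · rw [hpip, leg_beta hp]
    ring
end

section
/- Let p be a real number with p < 0 or p > 1 and q ∈ (1,∞). Then 2∫₀¹ (1−t^q)^{−1/p} dt = (2/q)·B(1/q, 1−1/p), where B is the Euler Beta function; that is, π_{p,q} = (2/q)·B(1/q, 1/p*) with 1/p + 1/p* = 1. -/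
open Real MeasureTheory Set Filter

theorem aux_beta_s4 (u v : ℝ) (hu : 0 < u) (hv : 0 < v) :
    ∫ x in Ioo (0:ℝ) 1, x ^ (u - 1) * (1 - x) ^ (v - 1) = Beta u v := by
  have h := Complex.Gamma_mul_Gamma_eq_betaIntegral (s := (u:ℂ)) (t := (v:ℂ)) (by simpa) (by simpa)
  have h2 : Complex.betaIntegral u v
      = ((∫ x in Ioo (0:ℝ) 1, x ^ (u - 1) * (1 - x) ^ (v - 1) : ℝ) : ℂ) := by
    rw [Complex.betaIntegral, intervalIntegral.integral_of_le zero_le_one,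
      integral_Ioc_eq_integral_Ioo, ← integral_complex_ofReal]
    refine setIntegral_congr_fun measurableSet_Ioo fun x hx => ?_
    have h1 : 0 ≤ 1 - x := by linarith [hx.2]
    simp only [Complex.ofReal_mul]
    rw [Complex.ofReal_cpow hx.1.le, Complex.ofReal_cpow h1]
    push_cast
    rfl
  rw [h2, ← Complex.ofReal_add, Complex.Gamma_ofReal, Complex.Gamma_ofReal,
    Complex.Gamma_ofReal] at h
  norm_cast at h
  have h3 : Real.Gamma (u + v) ≠ 0 := (Real.Gamma_pos_of_pos (by linarith)).ne'
  rw [Beta, eq_div_iff h3, h, mul_comm]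

theorem pi_pq_eq_beta (p q : ℝ) (hp : p < 0 ∨ 1 < p) (hq : 1 < q) :
    2 * ∫ t in (0:ℝ)..1, (1 - t ^ q) ^ (-(1 / p))
      = (2 / q) * Beta (1 / q) (1 - 1 / p) := by
  have hq0 : 0 < q := by linarith
  have hv : 0 < 1 - 1 / p := by
    rcases hp with hp | hp
    · have : 1 / p < 0 := one_div_neg.mpr hp
      linarith
    · have : 1 / p < 1 := by rw [div_lt_one (by linarith)]; exact hp
      linarith
  have him : (fun t : ℝ => t ^ q) '' Ioo 0 1 = Ioo 0 1 := by
    ext y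
    constructor
    · rintro ⟨t, ht, rfl⟩
      exact ⟨rpow_pos_of_pos ht.1 _, rpow_lt_one ht.1.le ht.2 hq0⟩
    · intro hy
      refine ⟨y ^ (1 / q), ⟨rpow_pos_of_pos hy.1 _, rpow_lt_one hy.1.le hy.2 (by positivity)⟩, ?_⟩
      change (y ^ (1 / q)) ^ q = y
      rw [← rpow_mul hy.1.le, one_div_mul_cancel hq0.ne', rpow_one]
  have hcv := integral_image_eq_integral_abs_deriv_smul (f := fun t : ℝ => t ^ q)
    (f' := fun t => q * t ^ (q - 1)) (s := Ioo 0 1) measurableSet_Ioo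
    (fun x hx => (Real.hasDerivAt_rpow_const (Or.inl hx.1.ne')).hasDerivWithinAt)
    (fun x hx y hy h => (rpow_left_inj hx.1.le hy.1.le hq0.ne').1 h)
    (fun x => x ^ (1 / q - 1) * (1 - x) ^ (1 - 1 / p - 1))
  rw [him, aux_beta_s4 _ _ (by positivity) hv] at hcv
  rw [hcv, intervalIntegral.integral_of_le zero_le_one, integral_Ioc_eq_integral_Ioo]
  have : ∫ x in Ioo (0:ℝ) 1, |q * x ^ (q - 1)| •
      ((x ^ q) ^ (1 / q - 1) * (1 - x ^ q) ^ (1 - 1 / p - 1))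
      = ∫ x in Ioo (0:ℝ) 1, q * (1 - x ^ q) ^ (-(1 / p)) := by
    refine setIntegral_congr_fun measurableSet_Ioo fun x hx => ?_
    have hx0 : 0 < x := hx.1
    have e : x ^ (q - 1) * (x ^ q) ^ (1 / q - 1) = 1 := by
      rw [← rpow_mul hx0.le, ← rpow_add hx0]
      have : q - 1 + q * (1 / q - 1) = 0 := by field_simp; ring
      rw [this, rpow_zero]
    have e2 : 1 - 1 / p - 1 = -(1 / p) := by ring
    simp only [smul_eq_mul]
    rw [abs_of_pos (by positivity), e2]
    linear_combination q * (1 - x ^ q) ^ (-(1 / p)) * e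
  rw [this, integral_const_mul]
  field_simp
end

section
/- Let p be a real number with p < 0 or p > 1 and q, r ∈ (1,∞). If 1/p + 1/r ≥ 1, then K_{p,q,r}(k) tends to +∞ as k → 1 from the left. -/
open Real MeasureTheory Set Filter

lemma genK_aux_integrable (a b q k : ℝ) (ha0 : 0 < a) (ha : a < 1) (hq : 1 < q)
    (hk0 : 0 < k) (hk1 : k < 1) :
    IntervalIntegrable (fun t : ℝ => (1 - t ^ q) ^ (-a) * (1 - k ^ q * t ^ q) ^ (-b))
      volume 0 1 := by
  have hq0 : 0 < q := by linarith
  have hc : Continuous (fun t : ℝ => t ^ q) := Real.continuous_rpow_const hq0.le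
  have hkq : k ^ q < 1 := Real.rpow_lt_one hk0.le hk1 hq0
  have hkq0 : 0 < k ^ q := Real.rpow_pos_of_pos hk0 q
  apply IntervalIntegrable.mul_continuousOn
  · have h1 : IntervalIntegrable (fun t : ℝ => t ^ (-a)) volume 0 1 :=
      intervalIntegral.intervalIntegrable_rpow' (by linarith)
    have h2 : IntervalIntegrable (fun t : ℝ => (1 - t) ^ (-a)) volume 0 1 := by
      have := (h1.comp_sub_left 1).symm
      simpa using this
    refine h2.mono_fun' ?_ ?_
    · exact ((measurable_const.sub hc.measurable).pow_const (-a)).aestronglyMeasurable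
    · rw [uIoc_of_le zero_le_one]
      have hne : ∀ᵐ t : ℝ ∂(volume.restrict (Ioc (0:ℝ) 1)), t ≠ 1 :=
        ae_restrict_of_ae (Measure.ae_ne volume 1)
      filter_upwards [ae_restrict_mem measurableSet_Ioc, hne] with t ht hne
      have ht1 : t < 1 := lt_of_le_of_ne ht.2 hne
      have : t ^ q ≤ t := by
        simpa using Real.rpow_le_rpow_of_exponent_ge ht.1 ht.2 hq.le
      rw [Real.norm_of_nonneg (Real.rpow_nonneg (by linarith) _)]
      exact Real.rpow_le_rpow_of_nonpos (by linarith) (by linarith) (by linarith)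
  · refine ContinuousOn.rpow_const (by fun_prop) ?_
    intro t ht
    left
    rw [uIcc_of_le zero_le_one] at ht
    have : t ^ q ≤ 1 := Real.rpow_le_one ht.1 ht.2 hq0.le
    have h0 : 0 ≤ t ^ q := Real.rpow_nonneg ht.1 _
    nlinarith

lemma genK_aux_bound (a b q k t : ℝ) (ha0 : 0 < a) (hb0 : 0 < b) (hab : 1 ≤ a + b) (hq : 1 < q)
    (hk1 : k < 1) (ht0 : 0 ≤ t) (htk : t ≤ k) :
    (2 * q) ^ (-(a + b)) * (1 - t)⁻¹ ≤ (1 - t ^ q) ^ (-a) * (1 - k ^ q * t ^ q) ^ (-b) := by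
  have hq0 : 0 < q := by linarith
  have hk0 : 0 ≤ k := ht0.trans htk
  have ht1 : t < 1 := by linarith
  have hu : 0 < 1 - t := by linarith
  have hB : ∀ x : ℝ, 0 ≤ x → 1 - x ^ q ≤ q * (1 - x) := by
    intro x hx
    have := one_add_mul_self_le_rpow_one_add (s := x - 1) (by linarith) hq.le
    rw [add_sub_cancel] at this
    linarith
  have hkt : k * t < 1 := by nlinarith
  have e1 : 1 - t ^ q ≤ 2 * q * (1 - t) := by nlinarith [hB t ht0, mul_pos hq0 hu]
  have e2 : 1 - k ^ q * t ^ q ≤ 2 * q * (1 - t) := by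
    rw [← Real.mul_rpow hk0 ht0]
    have h1 := hB (k * t) (by positivity)
    have h2 : 1 - k * t ≤ 2 * (1 - t) := by nlinarith
    nlinarith
  have p1 : 0 < 1 - t ^ q := by
    have := Real.rpow_lt_one ht0 ht1 hq0
    linarith
  have p2 : 0 < 1 - k ^ q * t ^ q := by
    rw [← Real.mul_rpow hk0 ht0]
    have := Real.rpow_lt_one (by positivity) hkt hq0
    linarith
  have hs : 0 < 2 * q * (1 - t) := by positivity
  calc (2 * q) ^ (-(a + b)) * (1 - t)⁻¹ ≤ (2 * q) ^ (-(a + b)) * (1 - t) ^ (-(a + b)) := by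
        refine mul_le_mul_of_nonneg_left ?_ (by positivity)
        rw [← Real.rpow_neg_one]
        exact Real.rpow_le_rpow_of_exponent_ge hu (by linarith) (by linarith)
    _ = (2 * q * (1 - t)) ^ (-a) * (2 * q * (1 - t)) ^ (-b) := by
        rw [← Real.mul_rpow (by positivity) hu.le, ← Real.rpow_add hs]
        congr 1
        ring
    _ ≤ _ := by
        apply mul_le_mul
        · exact Real.rpow_le_rpow_of_nonpos p1 e1 (by linarith)
        · exact Real.rpow_le_rpow_of_nonpos p2 e2 (by linarith)
        · positivity
        · positivity

theorem genK_tendsto_atTop (p q r : ℝ) (hp : p < 0 ∨ 1 < p) (hq : 1 < q) (hr : 1 < r)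
    (h : 1 ≤ 1 / p + 1 / r) :
    Tendsto (genK p q r) (nhdsWithin 1 (Iio (1:ℝ))) atTop := by
  have hb0 : 0 < 1 / r := by positivity
  have hb1 : 1 / r < 1 := by rw [div_lt_one] <;> linarith
  have hp1 : 1 < p := by
    rcases hp with hp | hp
    · have : 1 / p < 0 := one_div_neg.mpr hp
      linarith
    · exact hp
  have ha0 : 0 < 1 / p := by positivity
  have ha1 : 1 / p < 1 := by rw [div_lt_one] <;> linarith
  have hq0 : 0 < q := by linarith
  set a := 1 / p with ha
  set b := 1 / r with hb
  have hC : 0 < (2 * q) ^ (-(a + b)) := by positivity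
  have hlim : Tendsto (fun k : ℝ => (2 * q) ^ (-(a + b)) * (-Real.log (1 - k)))
      (nhdsWithin 1 (Iio (1:ℝ))) atTop := by
    refine Tendsto.const_mul_atTop hC (tendsto_neg_atBot_atTop.comp ?_)
    refine Real.tendsto_log_nhdsGT_zero.comp ?_
    refine tendsto_nhdsWithin_iff.mpr ⟨?_, ?_⟩
    · have : Tendsto (fun k : ℝ => 1 - k) (nhds 1) (nhds (1 - 1)) :=
        (continuous_const.sub continuous_id).tendsto 1
      rw [sub_self] at this
      exact this.mono_left nhdsWithin_le_nhds
    · filter_upwards [self_mem_nhdsWithin] with k hk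
      have hk' : k < 1 := hk
      exact sub_pos.mpr hk'
  refine tendsto_atTop_mono' _ ?_ hlim
  filter_upwards [Ioo_mem_nhdsLT (zero_lt_one' ℝ)] with k hk
  obtain ⟨hk0, hk1⟩ := hk
  have hint := genK_aux_integrable a b q k ha0 ha1 hq hk0 hk1
  have hI : ∫ t in (0:ℝ)..k, (2 * q) ^ (-(a + b)) * (1 - t)⁻¹
      = (2 * q) ^ (-(a + b)) * (-Real.log (1 - k)) := by
    rw [intervalIntegral.integral_const_mul,
      intervalIntegral.integral_comp_sub_left (fun x : ℝ => x⁻¹) 1,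
      integral_inv_of_pos (by linarith) (by norm_num)]
    simp
  have hsub : uIcc (0:ℝ) k ⊆ uIcc 0 1 := by
    rw [uIcc_of_le hk0.le, uIcc_of_le zero_le_one]
    exact Icc_subset_Icc_right hk1.le
  rw [← hI]
  unfold genK
  calc _ ≤ ∫ t in (0:ℝ)..k, (1 - t ^ q) ^ (-a) * (1 - k ^ q * t ^ q) ^ (-b) := by
        refine intervalIntegral.integral_mono_on hk0.le ?_ (hint.mono_set hsub) ?_
        · apply ContinuousOn.intervalIntegrable
          refine continuousOn_const.mul (ContinuousOn.inv₀ (by fun_prop) ?_)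
          intro t ht
          rw [uIcc_of_le hk0.le] at ht
          have := ht.2
          exact (by linarith : 0 < 1 - t).ne'
        · intro t ht
          exact genK_aux_bound a b q k t ha0 hb0 h hq hk1 ht.1 ht.2
    _ ≤ _ := by
        refine intervalIntegral.integral_mono_interval le_rfl hk0.le hk1.le ?_ hint
        filter_upwards [ae_restrict_mem measurableSet_Ioc] with t ht
        have h1 : t ^ q ≤ 1 := Real.rpow_le_one ht.1.le ht.2 hq0.le
        have h2 : k ^ q ≤ 1 := Real.rpow_le_one hk0.le hk1.le hq0.le
        have h3 : 0 ≤ t ^ q := Real.rpow_nonneg ht.1.le _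
        have h4 : k ^ q * t ^ q ≤ 1 := mul_le_one₀ h2 h3 h1
        exact mul_nonneg (Real.rpow_nonneg (by linarith) _) (Real.rpow_nonneg (by linarith) _)
end

section
/- Let p be a real number with p < 0 or p > 1 and q, r ∈ (1,∞). If 1/p + 1/r < 1, then K_{p,q,r}(k) tends to π_{u,q}/2 = (1/q)·B(1/q, 1−1/u) as k → 1 from the left, where 1/u = 1/p + 1/r and B is the Euler Beta function. -/
open Real MeasureTheory Set Filter

theorem realBeta_aux (a b : ℝ) (ha : 0 < a) (hb : 0 < b) :
    IntegrableOn (fun x : ℝ => x ^ (a - 1) * (1 - x) ^ (b - 1)) (Ioo 0 1) ∧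
    ∫ x in Ioo (0:ℝ) 1, x ^ (a - 1) * (1 - x) ^ (b - 1) = Beta a b := by
  have hc := Complex.betaIntegral_convergent (u := (a:ℂ)) (v := (b:ℂ)) (by simpa) (by simpa)
  rw [intervalIntegrable_iff_integrableOn_Ioo_of_le zero_le_one] at hc
  have heq : ∀ x ∈ Ioo (0:ℝ) 1, (x : ℂ) ^ ((a:ℂ) - 1) * (1 - (x : ℂ)) ^ ((b:ℂ) - 1)
      = ((x ^ (a - 1) * (1 - x) ^ (b - 1) : ℝ) : ℂ) := by
    intro x hx
    have h1 : (0:ℝ) ≤ 1 - x := by linarith [hx.2]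
    rw [Complex.ofReal_mul, Complex.ofReal_cpow hx.1.le, Complex.ofReal_cpow h1]
    push_cast
    rfl
  constructor
  · have h2 := (hc.congr_fun heq measurableSet_Ioo).re
    simpa [IntegrableOn] using h2
  · have h3 : Beta a b = (Complex.betaIntegral a b).re :=
      ProbabilityTheory.beta_eq_betaIntegralReal a b ha hb
    rw [h3, Complex.betaIntegral, intervalIntegral.integral_of_le zero_le_one,
      integral_Ioc_eq_integral_Ioo, setIntegral_congr_fun measurableSet_Ioo heq,
      integral_complex_ofReal, Complex.ofReal_re]

theorem lim_aux (q s : ℝ) (hq : 1 < q) (hs : s < 1) :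
    IntegrableOn (fun t : ℝ => (1 - t ^ q) ^ (-s)) (Ioo 0 1) ∧
    ∫ t in Ioo (0:ℝ) 1, (1 - t ^ q) ^ (-s) = (1 / q) * Beta (1 / q) (1 - s) := by
  have hq0 : 0 < q := by linarith
  obtain ⟨h1, h2⟩ := realBeta_aux (1 / q) (1 - s) (by positivity) (by linarith)
  set g : ℝ → ℝ := (Ioo (0:ℝ) 1).indicator
    (fun x : ℝ => x ^ (1 / q - 1) * (1 - x) ^ (1 - s - 1)) with hg
  have hsub : Ioo (0:ℝ) 1 ⊆ Ioi 0 := fun x hx => hx.1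
  have key : ∀ x ∈ Ioi (0:ℝ), x ^ (q - 1) • g (x ^ q)
      = (Ioo (0:ℝ) 1).indicator (fun t : ℝ => (1 - t ^ q) ^ (-s)) x := by
    intro x hx
    have hx : 0 < x := hx
    by_cases hx1 : x < 1
    · have hm : x ^ q ∈ Ioo (0:ℝ) 1 := ⟨rpow_pos_of_pos hx q, rpow_lt_one hx.le hx1 hq0⟩
      have hm' : x ∈ Ioo (0:ℝ) 1 := ⟨hx, hx1⟩
      rw [hg, indicator_of_mem hm, indicator_of_mem hm', smul_eq_mul, ← mul_assoc,
        ← rpow_mul hx.le, ← rpow_add hx]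
      have e1 : q - 1 + q * (1 / q - 1) = 0 := by field_simp; ring
      rw [e1, rpow_zero, one_mul]
      congr 1; ring
    · have hm : x ^ q ∉ Ioo (0:ℝ) 1 := fun h =>
        absurd h.2 (not_lt.2 (one_le_rpow (not_lt.1 hx1) hq0.le))
      have hm' : x ∉ Ioo (0:ℝ) 1 := fun h => hx1 h.2
      rw [hg, indicator_of_notMem hm, indicator_of_notMem hm', smul_zero]
  have hgi : IntegrableOn g (Ioi 0) :=
    ((integrable_indicator_iff measurableSet_Ioo).2 h1).integrableOn
  constructor
  · have h3 := (integrableOn_Ioi_comp_rpow_iff' g hq0.ne').2 hgi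
    have h4 := (h3.congr_fun key measurableSet_Ioi).mono_set hsub
    exact h4.congr_fun (fun x hx => indicator_of_mem hx _) measurableSet_Ioo
  · have h3 := integral_comp_rpow_Ioi_of_pos (g := g) hq0
    have h5 : ∫ y in Ioi (0:ℝ), g y = Beta (1 / q) (1 - s) := by
      rw [hg, setIntegral_indicator measurableSet_Ioo, inter_eq_self_of_subset_right hsub, h2]
    have h6 : ∫ x in Ioi (0:ℝ), (q * x ^ (q - 1)) • g (x ^ q)
        = q * ∫ t in Ioo (0:ℝ) 1, (1 - t ^ q) ^ (-s) := by
      rw [← inter_eq_self_of_subset_right hsub, ← setIntegral_indicator measurableSet_Ioo,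
        ← setIntegral_congr_fun measurableSet_Ioi key, ← integral_const_mul]
      simp only [smul_eq_mul, mul_assoc, inter_eq_self_of_subset_right hsub]
    rw [h5, h6] at h3
    rw [← h3]
    field_simp

theorem genK_tendsto_of_lt (p q r : ℝ) (hp : p < 0 ∨ 1 < p) (hq : 1 < q) (hr : 1 < r)
    (h : 1 / p + 1 / r < 1) :
    Tendsto (genK p q r) (nhdsWithin 1 (Iio (1:ℝ)))
      (nhds ((1 / q) * Beta (1 / q) (1 - (1 / p + 1 / r)))) := by
  have hq0 : 0 < q := by linarith
  have hr0 : 0 < 1 / r := by positivity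
  obtain ⟨h1, h2⟩ := lim_aux q _ hq h
  rw [← h2]
  have hK : genK p q r = fun k => ∫ t in Ioo (0:ℝ) 1,
      (1 - t ^ q) ^ (-(1 / p)) * (1 - k ^ q * t ^ q) ^ (-(1 / r)) := by
    funext k
    rw [genK, intervalIntegral.integral_of_le zero_le_one, integral_Ioc_eq_integral_Ioo]
  rw [hK]
  have hsplit : ∀ t ∈ Ioo (0:ℝ) 1, 0 < 1 - t ^ q ∧ (1 - t ^ q) ^ (-(1 / p + 1 / r))
      = (1 - t ^ q) ^ (-(1 / p)) * (1 - t ^ q) ^ (-(1 / r)) := by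
    intro t ht
    have : 0 < 1 - t ^ q := by linarith [rpow_lt_one ht.1.le ht.2 hq0]
    refine ⟨this, ?_⟩
    rw [← rpow_add this]; congr 1; ring
  refine tendsto_integral_filter_of_dominated_convergence
    (fun t : ℝ => (1 - t ^ q) ^ (-(1 / p + 1 / r))) ?_ ?_ h1 ?_
  · refine Eventually.of_forall fun k => Measurable.aestronglyMeasurable ?_
    fun_prop
  · have hk : ∀ᶠ k : ℝ in nhdsWithin 1 (Iio (1:ℝ)), k ∈ Ioo (0:ℝ) 1 :=
      Ioo_mem_nhdsLT zero_lt_one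
    filter_upwards [hk] with k hk
    refine (ae_restrict_iff' measurableSet_Ioo).2 (Eventually.of_forall fun t ht => ?_)
    obtain ⟨h3, h4⟩ := hsplit t ht
    have h5 : 1 - t ^ q ≤ 1 - k ^ q * t ^ q := by
      have := mul_le_mul_of_nonneg_right (rpow_lt_one hk.1.le hk.2 hq0).le
        (rpow_pos_of_pos ht.1 q).le
      linarith
    have h6 : 0 < 1 - k ^ q * t ^ q := by linarith
    rw [h4, Real.norm_of_nonneg (by positivity)]
    exact mul_le_mul_of_nonneg_left (rpow_le_rpow_of_nonpos h3 h5 (by linarith)) (by positivity)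
  · refine (ae_restrict_iff' measurableSet_Ioo).2 (Eventually.of_forall fun t ht => ?_)
    obtain ⟨h3, h4⟩ := hsplit t ht
    rw [h4]
    refine Tendsto.const_mul _ ?_
    have hcont : ContinuousAt (fun k : ℝ => (1 - k ^ q * t ^ q) ^ (-(1 / r))) 1 := by
      refine ContinuousAt.rpow_const ?_ (Or.inl ?_)
      · exact continuousAt_const.sub
          ((continuousAt_rpow_const 1 q (Or.inl one_ne_zero)).mul continuousAt_const)
      · simpa using h3.ne'
    have := hcont.tendsto
    simp only [one_rpow, one_mul] at this
    exact this.mono_left nhdsWithin_le_nhds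
end

section
/- Let p be a real number with p < 0 or p > 1 and q, r ∈ (1,∞). Then the function k ↦ E_{p,q,r}(k) is strictly decreasing on [0,1]. -/
open Real MeasureTheory Set Filter

theorem genE_integrable (p q r k : ℝ) (hp : p < 0 ∨ 1 < p) (hq : 1 < q) (hr : 1 < r)
    (hk : k ∈ Icc (0:ℝ) 1) : IntervalIntegrable
      (fun t : ℝ => (1 - k ^ q * t ^ q) ^ (1 - 1 / r) * (1 - t ^ q) ^ (-(1 / p))) volume 0 1 := by
  have hs : 0 < 1 - 1 / r := by
    have : 1 / r < 1 := by rw [div_lt_one (by linarith)]; exact hr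
    linarith
  have hdom : ∃ g : ℝ → ℝ, IntervalIntegrable g volume 0 1 ∧
      ∀ t ∈ Ioo (0:ℝ) 1, (1 - t ^ q) ^ (-(1 / p)) ≤ g t := by
    rcases hp with hp | hp
    · refine ⟨fun _ => 1, intervalIntegrable_const, fun t ht => ?_⟩
      have h1 : t ^ q ≤ 1 := Real.rpow_le_one ht.1.le ht.2.le (by linarith)
      have h0 : 0 ≤ t ^ q := Real.rpow_nonneg ht.1.le q
      have : 1 / p < 0 := one_div_neg.mpr hp
      exact Real.rpow_le_one (by linarith) (by linarith) (by linarith)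
    · have hp1 : 1 / p < 1 := by rw [div_lt_one (by linarith)]; exact hp
      have hp0 : 0 < 1 / p := by positivity
      refine ⟨fun t => (1 - t) ^ (-(1 / p)), ?_, fun t ht => ?_⟩
      · have := (intervalIntegral.intervalIntegrable_rpow' (a := 0) (b := 1)
          (r := -(1 / p)) (by linarith)).comp_sub_left 1
        simpa using this.symm
      · have h1 : t ^ q ≤ t := by
          simpa using Real.rpow_le_rpow_of_exponent_ge ht.1 ht.2.le hq.le
        exact Real.rpow_le_rpow_of_nonpos (by linarith [ht.2]) (by linarith) (by linarith)
  obtain ⟨g, hg, hle⟩ := hdom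
  rw [intervalIntegrable_iff_integrableOn_Ioo_of_le zero_le_one] at hg ⊢
  refine Integrable.mono' hg (Measurable.aestronglyMeasurable (by fun_prop)) ?_
  refine (ae_restrict_iff' measurableSet_Ioo).2 (Eventually.of_forall fun t ht => ?_)
  have h1 : t ^ q ≤ 1 := Real.rpow_le_one ht.1.le ht.2.le (by linarith)
  have h0 : 0 ≤ t ^ q := Real.rpow_nonneg ht.1.le q
  have k1 : k ^ q ≤ 1 := Real.rpow_le_one hk.1 hk.2 (by linarith)
  have k0 : 0 ≤ k ^ q := Real.rpow_nonneg hk.1 q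
  have hkt : k ^ q * t ^ q ≤ 1 := mul_le_one₀ k1 h0 h1
  have hkt0 : 0 ≤ k ^ q * t ^ q := mul_nonneg k0 h0
  have hA0 : 0 ≤ (1 - k ^ q * t ^ q) ^ (1 - 1 / r) := Real.rpow_nonneg (by linarith) _
  have hA1 : (1 - k ^ q * t ^ q) ^ (1 - 1 / r) ≤ 1 :=
    Real.rpow_le_one (by linarith) (by linarith) hs.le
  have hw : 0 ≤ (1 - t ^ q) ^ (-(1 / p)) := Real.rpow_nonneg (by linarith) _
  rw [Real.norm_of_nonneg (mul_nonneg hA0 hw)]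
  exact (mul_le_of_le_one_left hw hA1).trans (hle t ht)

theorem genE_strictAntiOn (p q r : ℝ) (hp : p < 0 ∨ 1 < p) (hq : 1 < q) (hr : 1 < r) :
    StrictAntiOn (genE p q r) (Icc (0:ℝ) 1) := by
  intro a ha b hb hab
  have hs : 0 < 1 - 1 / r := by
    have : 1 / r < 1 := by rw [div_lt_one (by linarith)]; exact hr
    linarith
  have ia := genE_integrable p q r a hp hq hr ha
  have ib := genE_integrable p q r b hp hq hr hb
  have key := intervalIntegral.intervalIntegral_pos_of_pos_on (ia.sub ib) ?_ zero_lt_one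
  · rw [intervalIntegral.integral_sub ia ib] at key
    unfold genE
    linarith
  · intro t ht
    have h1 : t ^ q < 1 := Real.rpow_lt_one ht.1.le ht.2 (by linarith)
    have h0 : 0 < t ^ q := Real.rpow_pos_of_pos ht.1 q
    have hlt : a ^ q < b ^ q := Real.rpow_lt_rpow ha.1 hab (by linarith)
    have b1 : b ^ q ≤ 1 := Real.rpow_le_one hb.1 hb.2 (by linarith)
    have hm : a ^ q * t ^ q < b ^ q * t ^ q := mul_lt_mul_of_pos_right hlt h0
    have hbt : b ^ q * t ^ q ≤ 1 := mul_le_one₀ b1 h0.le h1.le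
    have hA := Real.rpow_lt_rpow (x := 1 - b ^ q * t ^ q) (y := 1 - a ^ q * t ^ q)
      (by linarith) (by linarith) hs
    have hw : 0 < (1 - t ^ q) ^ (-(1 / p)) := Real.rpow_pos_of_pos (by linarith) _
    exact sub_pos.2 (mul_lt_mul_of_pos_right hA hw)
end

section
/- Let p be a real number with p < 0 or p > 1 and q, r ∈ (1,∞). Then for every k ∈ (0,1), the function E_{p,q,r} is differentiable at k with dE_{p,q,r}/dk = q·(E_{p,q,r}(k) − K_{p,q,r}(k))/(r*·k), where 1/r + 1/r* = 1. -/
open Real MeasureTheory Set Filter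

lemma genE_w_int (p q : ℝ) (hp : p < 0 ∨ 1 < p) (hq : 1 < q) :
    IntervalIntegrable (fun t : ℝ => (1 - t ^ q) ^ (-(1 / p))) volume 0 1 := by
  have hm : Measurable (fun t : ℝ => (1 - t ^ q) ^ (-(1 / p))) := by fun_prop
  have h1 : IntervalIntegrable (fun t : ℝ => 1 + (1 - t) ^ (-(1 / p))) volume 0 1 := by
    apply IntervalIntegrable.add intervalIntegrable_const
    have h2 : IntervalIntegrable (fun x : ℝ => x ^ (-(1 / p))) volume 0 1 := by
      apply intervalIntegral.intervalIntegrable_rpow'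
      rcases hp with hp | hp
      · have : 1 / p < 0 := one_div_neg.mpr hp
        linarith
      · have : 1 / p < 1 := by rw [div_lt_one (by linarith)]; exact hp
        linarith
    have := (h2.comp_sub_left 1).symm
    simpa using this
  refine h1.mono_fun' hm.aestronglyMeasurable ?_
  rw [uIoc_of_le zero_le_one]
  filter_upwards [ae_restrict_mem measurableSet_Ioc] with t ht
  have htq : t ^ q ≤ t := by
    have := Real.rpow_le_rpow_of_exponent_ge ht.1 ht.2 hq.le
    simpa using this
  have htq0 : 0 ≤ t ^ q := Real.rpow_nonneg ht.1.le q
  have h0 : 0 ≤ 1 - t ^ q := by linarith [ht.2]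
  have h0' : 0 ≤ 1 - t := by linarith [ht.2]
  rw [Real.norm_of_nonneg (Real.rpow_nonneg h0 _)]
  rcases hp with hp | hp
  · have : 1 / p < 0 := one_div_neg.mpr hp
    have h3 := Real.rpow_le_one h0 (by linarith) (show 0 ≤ -(1 / p) by linarith)
    have := Real.rpow_nonneg h0' (-(1 / p))
    linarith
  · rcases ht.2.lt_or_eq with h | h
    · have h4 : 0 < 1 / p := by positivity
      have := Real.rpow_le_rpow_of_nonpos (show 0 < 1 - t by linarith)
        (show 1 - t ≤ 1 - t ^ q by linarith) (show -(1 / p) ≤ 0 by linarith)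
      linarith
    · subst h
      simp

theorem genE_hasDerivAt (p q r : ℝ) (hp : p < 0 ∨ 1 < p) (hq : 1 < q) (hr : 1 < r)
    (rs : ℝ) (hrs : 1 / r + 1 / rs = 1) (k : ℝ) (hk : k ∈ Ioo (0:ℝ) 1) :
    HasDerivAt (genE p q r) (q * (genE p q r k - genK p q r k) / (rs * k)) k := by
  obtain ⟨hk0, hk1⟩ := hk
  have hw := genE_w_int p q hp hq
  have hr1 : 0 < 1 / r := by positivity
  have hr2 : 1 / r < 1 := by rw [div_lt_one (by linarith)]; exact hr
  set b := (k + 1) / 2 with hb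
  have hb1 : b < 1 := by linarith
  have hpos : ∀ x ∈ Ioo 0 b, ∀ t ∈ Icc (0:ℝ) 1, 1 - b ≤ 1 - x ^ q * t ^ q := by
    intro x hx t ht
    have h1 : x ^ q ≤ x := by
      have := Real.rpow_le_rpow_of_exponent_ge hx.1 (by linarith [hx.2]) hq.le
      simpa using this
    have h2 : t ^ q ≤ 1 := Real.rpow_le_one ht.1 ht.2 (by linarith)
    have h3 : 0 ≤ x ^ q := Real.rpow_nonneg hx.1.le q
    have := mul_le_of_le_one_right h3 h2
    linarith [hx.2]
  have hkb : k ∈ Ioo 0 b := ⟨hk0, by linarith⟩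
  have hcont : ∀ c : ℝ, ContinuousOn (fun t : ℝ => (1 - k ^ q * t ^ q) ^ c) (uIcc 0 1) := by
    intro c
    rw [uIcc_of_le zero_le_one]
    refine ContinuousOn.rpow_const ?_ ?_
    · have : Continuous fun t : ℝ => t ^ q := Real.continuous_rpow_const (by linarith)
      fun_prop
    · intro t ht
      left
      have := hpos k hkb t ht
      linarith
  have hE : IntervalIntegrable (fun t : ℝ => (1 - k ^ q * t ^ q) ^ (1 - 1 / r) *
      (1 - t ^ q) ^ (-(1 / p))) volume 0 1 := hw.continuousOn_mul (hcont _)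
  have hK : IntervalIntegrable (fun t : ℝ => (1 - t ^ q) ^ (-(1 / p)) *
      (1 - k ^ q * t ^ q) ^ (-(1 / r))) volume 0 1 := hw.mul_continuousOn (hcont _)
  have key := (intervalIntegral.hasDerivAt_integral_of_dominated_loc_of_deriv_le
    (μ := volume) (a := 0) (b := 1) (x₀ := k) (s := Ioo 0 b)
    (F := fun x t : ℝ => (1 - x ^ q * t ^ q) ^ (1 - 1 / r) * (1 - t ^ q) ^ (-(1 / p)))
    (F' := fun x t : ℝ => (-(q * x ^ (q - 1) * t ^ q) * (1 - 1 / r) *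
      (1 - x ^ q * t ^ q) ^ (1 - 1 / r - 1)) * (1 - t ^ q) ^ (-(1 / p)))
    (bound := fun t => (q * (1 - b) ^ (-(1 / r))) * ‖(1 - t ^ q) ^ (-(1 / p))‖)
    (Ioo_mem_nhds hkb.1 hkb.2) ?_ hE ?_ ?_ (hw.norm.const_mul _) ?_).2
  · refine HasDerivAt.congr_deriv (f := genE p q r) key (Eq.symm ?_)
    have hrs' : 1 / rs = 1 - 1 / r := by linarith
    have : q * (genE p q r k - genK p q r k) / (rs * k)
        = (q * (1 / rs) / k) * (genE p q r k - genK p q r k) := by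
      rw [mul_comm rs k, ← div_div]; ring
    rw [this, hrs', genE, genK, ← intervalIntegral.integral_sub hE hK,
      ← intervalIntegral.integral_const_mul]
    refine intervalIntegral.integral_congr ?_
    intro t ht
    rw [uIcc_of_le zero_le_one] at ht
    have hu : 0 < 1 - k ^ q * t ^ q := by linarith [hpos k hkb t ht]
    have e1 : (1 - k ^ q * t ^ q) ^ (1 - 1 / r) =
        (1 - k ^ q * t ^ q) * (1 - k ^ q * t ^ q) ^ (-(1 / r)) := by
      rw [sub_eq_add_neg 1 (1 / r), Real.rpow_add hu, Real.rpow_one]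
    have e2 : k ^ (q - 1) = k ^ q / k := Real.rpow_sub_one hk0.ne' q
    have e3 : 1 - 1 / r - 1 = -(1 / r) := by ring
    simp only [e1, e2, e3]
    ring
  · refine Eventually.of_forall fun x => Measurable.aestronglyMeasurable ?_
    fun_prop
  · refine Measurable.aestronglyMeasurable ?_
    fun_prop
  · refine Eventually.of_forall fun t ht x hx => ?_
    rw [uIoc_of_le zero_le_one] at ht
    have hu := hpos x hx t ⟨ht.1.le, ht.2⟩
    have e3 : 1 - 1 / r - 1 = -(1 / r) := by ring
    rw [norm_mul, e3]
    refine mul_le_mul_of_nonneg_right ?_ (norm_nonneg _)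
    have n1 : 0 ≤ x ^ (q - 1) := Real.rpow_nonneg hx.1.le _
    have n2 : x ^ (q - 1) ≤ 1 := Real.rpow_le_one hx.1.le (by linarith [hx.2]) (by linarith)
    have n3 : 0 ≤ t ^ q := Real.rpow_nonneg ht.1.le _
    have n4 : t ^ q ≤ 1 := Real.rpow_le_one ht.1.le ht.2 (by linarith)
    have n5 : 0 ≤ (1 - x ^ q * t ^ q) ^ (-(1 / r)) := Real.rpow_nonneg (by linarith) _
    have n6 : (1 - x ^ q * t ^ q) ^ (-(1 / r)) ≤ (1 - b) ^ (-(1 / r)) :=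
      Real.rpow_le_rpow_of_nonpos (by linarith) hu (by linarith)
    rw [norm_mul, Real.norm_of_nonneg n5]
    refine mul_le_mul ?_ n6 n5 (by linarith)
    rw [norm_mul, norm_neg, Real.norm_of_nonneg (by positivity),
      Real.norm_of_nonneg (show 0 ≤ 1 - 1 / r by linarith)]
    calc q * x ^ (q - 1) * t ^ q * (1 - 1 / r) ≤ q * 1 * 1 * 1 := by
          gcongr
          · linarith
      _ = q := by ring
  · refine Eventually.of_forall fun t ht x hx => ?_
    rw [uIoc_of_le zero_le_one] at ht
    have hu := hpos x hx t ⟨ht.1.le, ht.2⟩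
    have d1 : HasDerivAt (fun x : ℝ => x ^ q) (q * x ^ (q - 1)) x :=
      Real.hasDerivAt_rpow_const (Or.inl hx.1.ne')
    have d2 := ((d1.mul_const (t ^ q)).const_sub 1)
    exact (d2.rpow_const (p := 1 - 1 / r) (Or.inl (by linarith))).mul_const _
end

section
/- Let q, r ∈ (1,∞). Then for every k ∈ (0,1), the functions E_{∞,q,r} and K_{∞,q,r} are differentiable at k with dE_{∞,q,r}/dk = q·(E_{∞,q,r}(k) − K_{∞,q,r}(k))/(r*·k) and dK_{∞,q,r}/dk = ((1 + q/r*)·E_{∞,q,r}(k) − (1 + q/r* − k^q)·K_{∞,q,r}(k))/(k·(1−k^q)), where 1/r + 1/r* = 1. -/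
open Real MeasureTheory Set Filter

lemma aux_cont_s14 (q a : ℝ) (hq : 1 < q) (u : ℝ) (hu0 : 0 ≤ u) (hu1 : u < 1) :
    ContinuousAt (fun u : ℝ => (1 - u ^ q) ^ a) u := by
  have h : u ^ q < 1 := Real.rpow_lt_one hu0 hu1 (by linarith)
  apply ContinuousAt.rpow_const
  · exact continuousAt_const.sub (continuousAt_id.rpow_const (Or.inr (by linarith)))
  · left; linarith

lemma aux_int_s14 (q a : ℝ) (hq : 1 < q) (k : ℝ) (hk : k ∈ Ioo (0:ℝ) 1) :
    IntervalIntegrable (fun u : ℝ => (1 - u ^ q) ^ a) volume 0 k := by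
  apply ContinuousOn.intervalIntegrable
  intro u hu
  rw [uIcc_of_le hk.1.le] at hu
  exact (aux_cont_s14 q a hq u hu.1 (hu.2.trans_lt hk.2)).continuousWithinAt

lemma aux_subst (q a k : ℝ) (hk : 0 < k) :
    (∫ t in (0:ℝ)..1, (1 - k ^ q * t ^ q) ^ a) = (∫ u in (0:ℝ)..k, (1 - u ^ q) ^ a) / k := by
  have h := intervalIntegral.mul_integral_comp_mul_left (a := 0) (b := 1)
    (f := fun u : ℝ => (1 - u ^ q) ^ a) k
  simp only [mul_zero, mul_one] at h
  rw [← h, mul_div_cancel_left₀ _ hk.ne']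
  apply intervalIntegral.integral_congr
  intro t ht
  rw [uIcc_of_le zero_le_one] at ht
  simp only [Real.mul_rpow hk.le ht.1]

lemma aux_deriv (q a : ℝ) (hq : 1 < q) (k : ℝ) (hk : k ∈ Ioo (0:ℝ) 1) :
    HasDerivAt (fun k : ℝ => ∫ t in (0:ℝ)..1, (1 - k ^ q * t ^ q) ^ a)
      (((1 - k ^ q) ^ a - ∫ t in (0:ℝ)..1, (1 - k ^ q * t ^ q) ^ a) / k) k := by
  have hk0 := hk.1
  have h1 : HasDerivAt (fun k : ℝ => ∫ u in (0:ℝ)..k, (1 - u ^ q) ^ a) ((1 - k ^ q) ^ a) k := by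
    apply intervalIntegral.integral_hasDerivAt_right (aux_int_s14 q a hq k hk)
    · exact ContinuousAt.stronglyMeasurableAtFilter (s := Ioo (0:ℝ) 1) isOpen_Ioo
        (fun u hu => aux_cont_s14 q a hq u hu.1.le hu.2) k hk
    · exact aux_cont_s14 q a hq k hk.1.le hk.2
  have h2 := h1.div (hasDerivAt_id k) hk0.ne'
  have h3 := h2.congr_of_eventuallyEq (f₁ := fun k : ℝ => ∫ t in (0:ℝ)..1, (1 - k ^ q * t ^ q) ^ a)
    (by filter_upwards [lt_mem_nhds hk0] with x hx
        exact aux_subst q a x hx)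
  refine h3.congr_deriv ?_
  rw [aux_subst q a k hk0]
  simp only [id]
  field_simp

lemma aux_rel (q c : ℝ) (hq : 1 < q) (k : ℝ) (hk : k ∈ Ioo (0:ℝ) 1) :
    (1 - k ^ q) ^ c = (1 + q * c) * (∫ t in (0:ℝ)..1, (1 - k ^ q * t ^ q) ^ c)
      - q * c * (∫ t in (0:ℝ)..1, (1 - k ^ q * t ^ q) ^ (c - 1)) := by
  have hk0 := hk.1
  have h := intervalIntegral.integral_eq_sub_of_hasDerivAt (a := 0) (b := k)
    (f := fun u : ℝ => u * (1 - u ^ q) ^ c)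
    (f' := fun u : ℝ => (1 + q * c) * (1 - u ^ q) ^ c - q * c * (1 - u ^ q) ^ (c - 1))
    (by
      intro u hu
      rw [uIcc_of_le hk0.le] at hu
      have hlt : u ^ q < 1 := Real.rpow_lt_one hu.1 (hu.2.trans_lt hk.2) (by linarith)
      have hp : 0 < 1 - u ^ q := by linarith
      have d1 : HasDerivAt (fun u : ℝ => 1 - u ^ q) (-(q * u ^ (q - 1))) u :=
        (Real.hasDerivAt_rpow_const (Or.inr hq.le)).const_sub 1
      have d2 := (hasDerivAt_id u).mul (d1.rpow_const (p := c) (Or.inl hp.ne'))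
      refine HasDerivAt.congr_deriv (f := fun u : ℝ => u * (1 - u ^ q) ^ c) d2 ?_
      have e1 : u * u ^ (q - 1) = u ^ q := by
        rcases hu.1.eq_or_lt with h0 | h0
        · rw [← h0, zero_mul, Real.zero_rpow (by linarith)]
        · rw [Real.rpow_sub_one h0.ne']; field_simp
      have e2 : (1 - u ^ q) ^ c = (1 - u ^ q) * (1 - u ^ q) ^ (c - 1) := by
        rw [Real.rpow_sub_one hp.ne']; field_simp
      simp only [id]
      rw [e2]
      linear_combination (-q * c * (1 - u ^ q) ^ (c - 1)) * e1)
    (((aux_int_s14 q c hq k hk).const_mul _).sub ((aux_int_s14 q (c-1) hq k hk).const_mul _))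
  rw [intervalIntegral.integral_sub ((aux_int_s14 q c hq k hk).const_mul _)
    ((aux_int_s14 q (c-1) hq k hk).const_mul _), intervalIntegral.integral_const_mul,
    intervalIntegral.integral_const_mul] at h
  rw [aux_subst q c k hk0, aux_subst q (c - 1) k hk0]
  field_simp
  linarith

theorem genEInf_genKInf_hasDerivAt (q r : ℝ) (hq : 1 < q) (hr : 1 < r)
    (rs : ℝ) (hrs : 1 / r + 1 / rs = 1) (k : ℝ) (hk : k ∈ Ioo (0:ℝ) 1) :
    HasDerivAt (genEInf q r) (q * (genEInf q r k - genKInf q r k) / (rs * k)) k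
    ∧ HasDerivAt (genKInf q r)
        (((1 + q / rs) * genEInf q r k - (1 + q / rs - k ^ q) * genKInf q r k)
          / (k * (1 - k ^ q))) k := by
  have hk0 := hk.1
  have hlt : k ^ q < 1 := Real.rpow_lt_one hk.1.le hk.2 (by linarith)
  have hp : 0 < 1 - k ^ q := by linarith
  have hc : 1 - 1 / r = 1 / rs := by linarith
  have hrs0 : rs ≠ 0 := by
    rintro rfl
    have : 1 / r < 1 := by rw [div_lt_one (by linarith)]; exact hr
    simp at hrs
    linarith
  have hrel : (1 - k ^ q) ^ (1 - 1 / r) = (1 + q * (1 / rs)) * genEInf q r k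
      - q * (1 / rs) * genKInf q r k := by
    have := aux_rel q (1 - 1 / r) hq k hk
    rw [show 1 - 1 / r - 1 = -(1 / r) by ring] at this
    rw [← hc]
    exact this
  have hrel2 : (1 - k ^ q) ^ (-(1 / r)) = (1 - k ^ q) ^ (1 - 1 / r) / (1 - k ^ q) := by
    rw [← Real.rpow_sub_one hp.ne']
    congr 1
    ring
  constructor
  · have h : HasDerivAt (genEInf q r) (((1 - k ^ q) ^ (1 - 1 / r) - genEInf q r k) / k) k :=
      aux_deriv q (1 - 1 / r) hq k hk
    refine h.congr_deriv ?_
    rw [hrel]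
    field_simp
    ring
  · have h : HasDerivAt (genKInf q r) (((1 - k ^ q) ^ (-(1 / r)) - genKInf q r k) / k) k :=
      aux_deriv q (-(1 / r)) hq k hk
    refine h.congr_deriv ?_
    rw [hrel2, hrel]
    have := hp.ne'
    field_simp
    ring
end
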